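/- In the quadrilateral configuration, the maximal speed on the upper level arc is at most the maximal speed on the lower level arc: max_{x ∈ ω} |∇u(x)| ≤ max_{x ∈ σ} |∇u(x)|. -/

import Mathlib

open Set Metric Filter
open scoped RealInnerProductSpace Classical

noncomputable section

abbrev E2 : Type := EuclideanSpace ℝ (Fin 2)

/-- The ∞-Laplacian `Δ∞φ(x) = ⟨D²φ(x)∇φ(x), ∇φ(x)⟩`. -/
def lapInf (φ : E2 → ℝ) (x : E2) : ℝ :=
  ⟪fderiv ℝ (gradient φ) x (gradient φ x), gradient φ x⟫

/-- `u` is ∞-harmonic in `G` in the viscosity sense. -/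
def ViscosityInftyHarmonic (u : E2 → ℝ) (G : Set E2) : Prop :=
  ∀ x₀ ∈ G, ∀ φ : E2 → ℝ, ContDiffAt ℝ 2 φ x₀ →
    (IsLocalMax (fun x => u x - φ x) x₀ → 0 ≤ lapInf φ x₀) ∧
    (IsLocalMin (fun x => u x - φ x) x₀ → lapInf φ x₀ ≤ 0)

/-- `α` is a streamline of the gradient field `Du` on `[0, T]`: it stays in `closure G`
and solves `α'(t) = Du(α(t))` for `0 ≤ t < T` (one-sidedly at `t = 0`). -/
def IsStreamline (G : Set E2) (Du : E2 → E2) (α : ℝ → E2) (T : ℝ) : Prop :=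
  0 ≤ T ∧ (∀ t ∈ Set.Icc 0 T, α t ∈ closure G) ∧
    HasDerivWithinAt α (Du (α 0)) (Set.Ici 0) 0 ∧
    ∀ t ∈ Set.Ioo 0 T, HasDerivAt α (Du (α t)) t

/-- `J` is a Jordan curve: the injective continuous image of a circle. -/
def IsJordanCurve (J : Set E2) : Prop :=
  ∃ γ : ℝ → E2, ContinuousOn γ (Set.Icc 0 1) ∧ γ 0 = γ 1 ∧
    Set.InjOn γ (Set.Ico 0 1) ∧ J = γ '' Set.Icc 0 1

/-- `w` is a viscosity subsolution of the ∞-Laplace equation in `G`. -/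
def IsSub (w : E2 → ℝ) (G : Set E2) : Prop :=
  ∀ x₀ ∈ G, ∀ φ : E2 → ℝ, ContDiffAt ℝ 2 φ x₀ →
    IsLocalMax (fun x => w x - φ x) x₀ → 0 ≤ lapInf φ x₀

lemma hasFDerivAt_norm_sub (x w : E2) (hw : w ≠ x) :
    HasFDerivAt (fun w : E2 => ‖w - x‖) (‖w - x‖⁻¹ • innerSL ℝ (w - x)) w := by
  have h0 : ‖w - x‖ ≠ 0 := norm_ne_zero_iff.2 (sub_ne_zero.2 hw)
  have h1 : HasFDerivAt (fun w : E2 => ‖w - x‖ ^ 2) (2 • innerSL ℝ (w - x)) w := by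
    simpa using ((hasFDerivAt_id w).sub_const x).norm_sq
  have h2 := h1.sqrt (by positivity)
  have h3 : (fun w : E2 => √(‖w - x‖ ^ 2)) = fun w : E2 => ‖w - x‖ := by
    ext w; exact Real.sqrt_sq (norm_nonneg _)
  rw [h3, Real.sqrt_sq (norm_nonneg _)] at h2
  refine h2.congr_fderiv ?_
  ext z
  simp
  field_simp

lemma hasGradientAt_cone (x w : E2) (hw : w ≠ x) (A B κ : ℝ) :
    HasGradientAt (fun w : E2 => A + B * ‖w - x‖ - κ * ‖w - x‖ ^ 2)
      ((B * ‖w - x‖⁻¹ - 2 * κ) • (w - x)) w := by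
  rw [hasGradientAt_iff_hasFDerivAt]
  have h0 : ‖w - x‖ ≠ 0 := norm_ne_zero_iff.2 (sub_ne_zero.2 hw)
  have h1 : HasFDerivAt (fun w : E2 => ‖w - x‖ ^ 2) (2 • innerSL ℝ (w - x)) w := by
    simpa using ((hasFDerivAt_id w).sub_const x).norm_sq
  have h2 := (((hasFDerivAt_norm_sub x w hw).const_mul B).const_add A).sub (h1.const_mul κ)
  refine h2.congr_fderiv ?_
  ext z
  simp
  ring

lemma lapInf_cone (x x₀ : E2) (hx : x₀ ≠ x) (A B κ : ℝ) :
    lapInf (fun w : E2 => A + B * ‖w - x‖ - κ * ‖w - x‖ ^ 2) x₀ =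
      -2 * κ * (B * ‖x₀ - x‖⁻¹ - 2 * κ) ^ 2 * ‖x₀ - x‖ ^ 2 := by
  set φ := fun w : E2 => A + B * ‖w - x‖ - κ * ‖w - x‖ ^ 2 with hφ
  set H := fun w : E2 => (B * ‖w - x‖⁻¹ - 2 * κ) • (w - x) with hH
  have h0 : ‖x₀ - x‖ ≠ 0 := norm_ne_zero_iff.2 (sub_ne_zero.2 hx)
  have hg : gradient φ =ᶠ[nhds x₀] H := by
    filter_upwards [isOpen_ne.mem_nhds hx] with w hw
    exact (hasGradientAt_cone x w hw A B κ).gradient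
  have hd : DifferentiableAt ℝ H x₀ := by
    have := (hasFDerivAt_norm_sub x x₀ hx).differentiableAt
    exact (((this.inv h0).const_mul B).sub_const (2 * κ)).smul (differentiableAt_id.sub_const x)
  have hv : fderiv ℝ H x₀ (x₀ - x) = (-2 * κ) • (x₀ - x) := by
    have hl : HasDerivAt (fun τ : ℝ => x₀ + τ • (x₀ - x)) (x₀ - x) 0 := by
      simpa using ((hasDerivAt_id (0 : ℝ)).smul_const (x₀ - x)).const_add x₀
    have h1 : HasDerivAt (H ∘ fun τ : ℝ => x₀ + τ • (x₀ - x)) (fderiv ℝ H x₀ (x₀ - x)) 0 := by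
      apply HasFDerivAt.comp_hasDerivAt
      · simpa using hd.hasFDerivAt
      · exact hl
    have h2 : HasDerivAt (fun τ : ℝ => (B * ‖x₀ - x‖⁻¹ - 2 * κ * (1 + τ)) • (x₀ - x))
        ((-2 * κ) • (x₀ - x)) 0 := by
      have : HasDerivAt (fun τ : ℝ => B * ‖x₀ - x‖⁻¹ - 2 * κ * (1 + τ)) (-2 * κ) 0 := by
        have := (((hasDerivAt_id (0 : ℝ)).const_add 1).const_mul (2 * κ)).const_sub (B * ‖x₀ - x‖⁻¹)
        simpa using this
      exact this.smul_const _
    refine h1.unique (h2.congr_of_eventuallyEq ?_)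
    have : ∀ᶠ τ : ℝ in nhds 0, -1 < τ := lt_mem_nhds (by norm_num)
    filter_upwards [this] with τ hτ
    have e : x₀ + τ • (x₀ - x) - x = (1 + τ) • (x₀ - x) := by module
    have hp : 0 < 1 + τ := by linarith
    simp only [hH, Function.comp, e, norm_smul, Real.norm_eq_abs, abs_of_pos hp, smul_smul]
    congr 1
    field_simp
  unfold lapInf
  rw [hg.fderiv_eq, hg.eq_of_nhds]
  simp only [hH] at hv ⊢
  rw [map_smul, hv, inner_smul_left, inner_smul_left, inner_smul_right, real_inner_self_eq_norm_sq]
  simp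
  ring

lemma contDiffAt_cone (x x₀ : E2) (hx : x₀ ≠ x) (A B κ : ℝ) :
    ContDiffAt ℝ 2 (fun w : E2 => A + B * ‖w - x‖ - κ * ‖w - x‖ ^ 2) x₀ := by
  have h : ContDiffAt ℝ 2 (fun w : E2 => ‖w - x‖) x₀ :=
    ContDiffAt.norm ℝ (contDiffAt_id.sub contDiffAt_const) (sub_ne_zero.2 hx)
  exact (contDiffAt_const.add (contDiffAt_const.mul h)).sub (contDiffAt_const.mul (h.pow 2))

/-- Comparison with cones from above on a ball. -/
lemma IsSub.le_cone {w : E2 → ℝ} {G : Set E2} (hw : IsSub w G) {x : E2} {ρ M : ℝ} (hρ : 0 < ρ)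
    (hG : closedBall x ρ ⊆ G) (hc : ContinuousOn w (closedBall x ρ))
    (hM : ∀ ζ ∈ closedBall x ρ, w ζ ≤ M) {ζ : E2} (hζ : ζ ∈ closedBall x ρ) :
    w ζ ≤ w x + (M - w x) / ρ * ‖ζ - x‖ := by
  by_contra! hlt
  set s := (M - w x) / ρ with hs
  have hMx : w x ≤ M := hM x (mem_closedBall_self hρ.le)
  have hs0 : 0 ≤ s := div_nonneg (by linarith) hρ.le
  have hsρ : s * ρ = M - w x := by rw [hs]; field_simp
  obtain ⟨κ, hκ, hκ2⟩ : ∃ κ > 0, κ * (2 * ρ * ρ) < w ζ - (w x + s * ‖ζ - x‖) := by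
    refine ⟨(w ζ - (w x + s * ‖ζ - x‖)) / (4 * ρ * ρ), by
      apply div_pos (by linarith) (by positivity), ?_⟩
    have : 0 < w ζ - (w x + s * ‖ζ - x‖) := by linarith
    field_simp
    linarith
  set φ := fun y : E2 => w x + (s + 2 * κ * ρ) * ‖y - x‖ - κ * ‖y - x‖ ^ 2 with hφ
  have hφc : Continuous φ := by fun_prop
  obtain ⟨z, hz, hmax⟩ := (isCompact_closedBall x ρ).exists_isMaxOn ⟨ζ, hζ⟩
    (hc.sub hφc.continuousOn)
  have h1 : w ζ - φ ζ ≤ w z - φ z := hmax hζ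
  rw [mem_closedBall, dist_eq_norm] at hζ
  have hpos : 0 < w z - φ z := by
    refine lt_of_lt_of_le ?_ h1
    have : 2 * κ * ρ * ‖ζ - x‖ ≤ 2 * κ * ρ * ρ := by gcongr
    have : 0 ≤ κ * ‖ζ - x‖ ^ 2 := by positivity
    simp only [hφ]
    linarith
  have hzx : z ≠ x := by
    rintro rfl
    simp [hφ] at hpos
  have hzb : ‖z - x‖ < ρ := by
    rcases lt_or_eq_of_le (by simpa [dist_eq_norm] using hz : ‖z - x‖ ≤ ρ) with h | h
    · exact h
    · exfalso
      have := hM z hz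
      simp only [hφ, h] at hpos
      nlinarith [mul_pos hκ (mul_pos hρ hρ)]
  have hloc : IsLocalMax (fun y => w y - φ y) z :=
    hmax.isLocalMax (closedBall_mem_nhds_of_mem (by simpa [dist_eq_norm] using hzb))
  have h2 := hw z (hG hz) φ (contDiffAt_cone x z hzx _ _ _) hloc
  rw [lapInf_cone x z hzx] at h2
  have hn : 0 < ‖z - x‖ := norm_pos_iff.2 (sub_ne_zero.2 hzx)
  have h3 : 0 < (s + 2 * κ * ρ) * ‖z - x‖⁻¹ - 2 * κ := by
    rw [sub_pos, ← div_eq_mul_inv, lt_div_iff₀ hn]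
    nlinarith
  have h4 : 0 < 2 * κ * ((s + 2 * κ * ρ) * ‖z - x‖⁻¹ - 2 * κ) ^ 2 * ‖z - x‖ ^ 2 := by positivity
  linarith

/-- First-order expansion of `w` at `x` along the direction `h`, from below. -/
lemma eventually_le_of_hasFDerivWithinAt {w : E2 → ℝ} {d x h : E2} {S : Set E2}
    (hd : HasFDerivWithinAt w (innerSL ℝ d) S x) (hS : ∀ᶠ τ : ℝ in nhdsWithin 0 (Ioi 0), x + τ • h ∈ S)
    {k : ℝ} (hk : k < ⟪d, h⟫) : ∀ᶠ τ : ℝ in nhdsWithin 0 (Ioi 0), w x + τ * k ≤ w (x + τ • h) := by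
  set T := {τ : ℝ | x + τ • h ∈ S} ∩ Ioi 0 with hT
  have hl : HasDerivWithinAt (fun τ : ℝ => x + τ • h) h T 0 := by
    simpa using (((hasDerivAt_id (0 : ℝ)).smul_const h).const_add x).hasDerivWithinAt
  have h1 : HasDerivWithinAt (w ∘ fun τ : ℝ => x + τ • h) (innerSL ℝ d h) T 0 := by
    apply HasFDerivWithinAt.comp_hasDerivWithinAt (t := S)
    · simpa using hd
    · exact hl
    · intro τ hτ; exact hτ.1
  have hTn : T ∈ nhdsWithin (0 : ℝ) (Ioi 0) := inter_mem hS self_mem_nhdsWithin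
  have h2 : HasDerivWithinAt (w ∘ fun τ : ℝ => x + τ • h) (innerSL ℝ d h) (Ioi 0) 0 :=
    h1.mono_of_mem_nhdsWithin hTn
  have h3 := hasDerivWithinAt_iff_tendsto_slope.1 h2
  rw [sdiff_singleton_eq_self (by simp)] at h3
  have h4 := h3.eventually (lt_mem_nhds (show k < innerSL ℝ d h from hk))
  filter_upwards [h4, self_mem_nhdsWithin] with τ hτ hp
  simp only [slope, Function.comp, sub_zero, zero_smul, add_zero, vsub_eq_sub, smul_eq_mul] at hτ
  have hp : 0 < τ := hp
  rw [inv_mul_eq_div, lt_div_iff₀ hp] at hτ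
  linarith

lemma inner_le_of_le {w : E2 → ℝ} {d x h : E2} {S : Set E2}
    (hd : HasFDerivWithinAt w (innerSL ℝ d) S x) {k : ℝ}
    (hS : ∀ᶠ τ : ℝ in nhdsWithin 0 (Ioi 0), x + τ • h ∈ S ∧ w (x + τ • h) ≤ w x + τ * k) :
    ⟪d, h⟫ ≤ k := by
  by_contra! hlt
  obtain ⟨k', h1, h2⟩ := exists_between hlt
  have h3 := eventually_le_of_hasFDerivWithinAt hd (hS.mono fun _ h => h.1) h2
  obtain ⟨τ, ⟨h4, h5⟩, h6⟩ := ((h3.and hS).and self_mem_nhdsWithin).exists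
  have h6 : 0 < τ := h6
  nlinarith [h5.2]

lemma HasGradientAt.hasFDerivWithinAt_innerSL {w : E2 → ℝ} {d x : E2} (h : HasGradientAt w d x) (S : Set E2) :
    HasFDerivWithinAt w (innerSL ℝ d) S x := by
  have := (hasGradientAt_iff_hasFDerivAt.1 h).hasFDerivWithinAt (s := S)
  exact this

/-- A subsolution grows at least linearly with rate `‖∇w(x)‖` on balls around `x`. -/
lemma IsSub.exists_ge {w : E2 → ℝ} {G : Set E2} (hw : IsSub w G) {x d : E2} {ρ : ℝ} (hρ : 0 < ρ)
    (hG : closedBall x ρ ⊆ G) (hc : ContinuousOn w (closedBall x ρ)) (hd : HasGradientAt w d x) :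
    ∃ z ∈ closedBall x ρ, (∀ ζ ∈ closedBall x ρ, w ζ ≤ w z) ∧ w x + ‖d‖ * ρ ≤ w z := by
  obtain ⟨z, hz, hmax⟩ := (isCompact_closedBall x ρ).exists_isMaxOn
    ⟨x, mem_closedBall_self hρ.le⟩ hc
  refine ⟨z, hz, fun ζ h => hmax h, ?_⟩
  have hxz : w x ≤ w z := hmax (mem_closedBall_self hρ.le)
  rcases eq_or_ne d 0 with rfl | hd0
  · simpa using hxz
  have hn : 0 < ‖d‖ := norm_pos_iff.2 hd0
  have h := inner_le_of_le (h := d) (k := (w z - w x) / ρ * ‖d‖)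
    (hd.hasFDerivWithinAt_innerSL univ) ?_
  · rw [real_inner_self_eq_norm_sq, div_mul_eq_mul_div, le_div_iff₀ hρ] at h
    nlinarith
  · have : ∀ᶠ τ : ℝ in nhdsWithin 0 (Ioi 0), τ < ρ / ‖d‖ :=
      nhdsWithin_le_nhds (gt_mem_nhds (by positivity))
    filter_upwards [this, self_mem_nhdsWithin] with τ h1 h2
    have h2 : 0 < τ := h2
    rw [lt_div_iff₀ hn] at h1
    refine ⟨mem_univ _, ?_⟩
    have e : ‖x + τ • d - x‖ = τ * ‖d‖ := by
      rw [add_sub_cancel_left, norm_smul, Real.norm_eq_abs, abs_of_pos h2]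
    have := hw.le_cone hρ hG hc (fun ζ h => hmax h) (ζ := x + τ • d)
      (by rw [mem_closedBall, dist_eq_norm, e]; exact h1.le)
    rw [e] at this
    linarith

/-- The ∞-potential of the convex ring `Ω \ K`, extended by `1` on `K` and by `0` outside `Ω`. -/
structure IsPotential (Ω K : Set E2) (v : E2 → ℝ) (Du : E2 → E2) : Prop where
  isOpen : IsOpen Ω
  isBounded : Bornology.IsBounded Ω
  convex : Convex ℝ Ω
  isCompact : IsCompact K
  convexK : Convex ℝ K
  subset : K ⊆ Ω
  continuous : Continuous v
  eq_one : ∀ x ∈ K, v x = 1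
  eq_zero : ∀ x ∉ Ω, v x = 0
  pos : ∀ x ∈ Ω \ K, 0 < v x
  lt_one : ∀ x ∈ Ω \ K, v x < 1
  grad : ∀ x ∈ Ω \ K, HasGradientAt v (Du x) x
  ne_zero : ∀ x ∈ Ω \ K, Du x ≠ 0
  sub : IsSub v (Ω \ K)
  super : IsSub (fun x => -v x) (Ω \ K)

namespace IsPotential

variable {Ω K : Set E2} {v : E2 → ℝ} {Du : E2 → E2}

lemma isOpen_ring (H : IsPotential Ω K v Du) : IsOpen (Ω \ K) :=
  H.isOpen.sdiff H.isCompact.isClosed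

lemma nonneg (H : IsPotential Ω K v Du) (x : E2) : 0 ≤ v x := by
  by_cases h : x ∈ Ω
  · by_cases h' : x ∈ K
    · rw [H.eq_one x h']; norm_num
    · exact (H.pos x ⟨h, h'⟩).le
  · rw [H.eq_zero x h]

lemma le_one (H : IsPotential Ω K v Du) (x : E2) : v x ≤ 1 := by
  by_cases h : x ∈ Ω
  · by_cases h' : x ∈ K
    · rw [H.eq_one x h']
    · exact (H.lt_one x ⟨h, h'⟩).le
  · rw [H.eq_zero x h]; norm_num

lemma mem_of_pos (H : IsPotential Ω K v Du) {x : E2} (h : 0 < v x) : x ∈ Ω := by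
  by_contra h'
  rw [H.eq_zero x h'] at h
  exact lt_irrefl _ h

lemma mem_of_eq_one (H : IsPotential Ω K v Du) {x : E2} (h : v x = 1) : x ∈ K := by
  by_contra h'
  exact (H.lt_one x ⟨H.mem_of_pos (by rw [h]; norm_num), h'⟩).ne h

lemma mem_ring (H : IsPotential Ω K v Du) {x : E2} (h : 0 < v x) (h1 : v x < 1) : x ∈ Ω \ K :=
  ⟨H.mem_of_pos h, fun h' => h1.ne (H.eq_one x h')⟩

lemma not_isLocalMin (H : IsPotential Ω K v Du) {x : E2} (hx : x ∈ Ω \ K) :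
    ¬ IsLocalMin v x := by
  intro h
  have := h.hasFDerivAt_eq_zero (hasGradientAt_iff_hasFDerivAt.1 (H.grad x hx))
  exact H.ne_zero x hx ((map_eq_zero_iff _ (InnerProductSpace.toDual ℝ E2).injective).1 this)

lemma neg_grad (H : IsPotential Ω K v Du) {x : E2} (hx : x ∈ Ω \ K) :
    HasGradientAt (fun y => -v y) (-Du x) x := by
  have := H.grad x hx
  rw [hasGradientAt_iff_hasFDerivAt] at this ⊢
  exact this.neg.congr_fderiv (by simp)

/-- One descending step: the minimum of `v` over a small ball. -/
lemma exists_descent (H : IsPotential Ω K v Du) {x : E2} {r : ℝ} (hr : 0 < r)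
    (hG : closedBall x r ⊆ Ω \ K) :
    ∃ y ∈ closedBall x r, (∀ ζ ∈ closedBall x r, v y ≤ v ζ) ∧ v y ≤ v x - ‖Du x‖ * r ∧
      ‖Du x‖ ≤ ‖Du y‖ := by
  have hx := hG (mem_closedBall_self hr.le)
  have hc : ContinuousOn (fun y => -v y) (closedBall x r) := H.continuous.neg.continuousOn
  obtain ⟨y, hy, hmin, hle⟩ := H.super.exists_ge hr hG hc (H.neg_grad hx)
  rw [norm_neg] at hle
  refine ⟨y, hy, fun ζ hζ => by linarith [hmin ζ hζ], by linarith, ?_⟩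
  have hDx : 0 < ‖Du x‖ := norm_pos_iff.2 (H.ne_zero x hx)
  have hyr : ‖y - x‖ ≤ r := by simpa [dist_eq_norm] using hy
  have h' := inner_le_of_le (w := fun z => -v z) (h := x - y) (k := -(v x - v y))
    ((H.neg_grad (hG hy)).hasFDerivWithinAt_innerSL univ) ?_
  · have h1 : ⟪-Du y, x - y⟫ ≥ -(‖Du y‖ * ‖y - x‖) := by
      have := neg_le_of_abs_le (abs_real_inner_le_norm (-Du y) (x - y))
      rwa [norm_neg, norm_sub_rev] at this
    have h2 : ‖Du y‖ * ‖y - x‖ ≤ ‖Du y‖ * r := by gcongr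
    have h3 : ‖Du x‖ * r ≤ ‖Du y‖ * r := by linarith
    exact le_of_mul_le_mul_right h3 hr
  · have : ∀ᶠ τ : ℝ in nhdsWithin 0 (Ioi 0), τ < 1 :=
      nhdsWithin_le_nhds (gt_mem_nhds one_pos)
    filter_upwards [this, self_mem_nhdsWithin] with τ h1 h2
    have h2 : 0 < τ := h2
    refine ⟨mem_univ _, ?_⟩
    have e : ‖y + τ • (x - y) - x‖ = (1 - τ) * ‖y - x‖ := by
      rw [show y + τ • (x - y) - x = (1 - τ) • (y - x) by module, norm_smul, Real.norm_eq_abs,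
        abs_of_pos (by linarith)]
    have h3 : (1 - τ) * ‖y - x‖ ≤ (1 - τ) * r := by gcongr
    have h4 : (1 - τ) * r ≤ r := by nlinarith
    have h5 := H.super.le_cone hr hG hc hmin (ζ := y + τ • (x - y))
      (by rw [mem_closedBall, dist_eq_norm, e]; linarith)
    rw [e] at h5
    have h6 : (-v y - -v x) / r * ((1 - τ) * ‖y - x‖) ≤ (-v y - -v x) / r * ((1 - τ) * r) := by
      apply mul_le_mul_of_nonneg_left h3
      apply div_nonneg _ hr.le
      nlinarith
    have h7 : (-v y - -v x) / r * ((1 - τ) * r) = (v x - v y) * (1 - τ) := by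
      field_simp
      ring
    linarith

set_option maxHeartbeats 1000000 in
/-- No strictly concave increasing radial function touches the quasiconcave envelope from above. -/
lemma not_touching (H : IsPotential Ω K v Du) {x y z : E2} {lam ρ s κ : ℝ}
    (hy : y ∈ Ω \ K) (hz : z ∈ Ω \ K) (hyz : v y = v z) (hl0 : 0 ≤ lam) (hl1 : lam ≤ 1)
    (hs : 0 ≤ s) (hκ : 0 < κ)
    (hR0 : 0 < ‖lam • y + (1 - lam) • z - x‖) (hRρ : ‖lam • y + (1 - lam) • z - x‖ < ρ)
    (hmax : ∀ y' ∈ Ω, ∀ z' ∈ Ω, ‖lam • y' + (1 - lam) • z' - x‖ ≤ ρ →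
      min (v y') (v z') - ((s + 2 * κ * ρ) * ‖lam • y' + (1 - lam) • z' - x‖
        - κ * ‖lam • y' + (1 - lam) • z' - x‖ ^ 2) ≤
      v y - ((s + 2 * κ * ρ) * ‖lam • y + (1 - lam) • z - x‖
        - κ * ‖lam • y + (1 - lam) • z - x‖ ^ 2)) : False := by
  set ζ := lam • y + (1 - lam) • z with hζ
  set R := ‖ζ - x‖ with hR
  set p := ‖Du y‖ with hp
  set q := ‖Du z‖ with hq
  have hp0 : 0 < p := norm_pos_iff.2 (H.ne_zero y hy)
  have hq0 : 0 < q := norm_pos_iff.2 (H.ne_zero z hz)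
  set L := lam / p + (1 - lam) / q with hL
  have hL0 : 0 < L := by
    rcases hl0.eq_or_lt with h | h
    · rw [hL, ← h]; simp; positivity
    · have : 0 ≤ (1 - lam) / q := div_nonneg (by linarith) hq0.le
      have : 0 < lam / p := by positivity
      linarith
  set g' := s + 2 * κ * (ρ - R) with hg'
  have hg'0 : 0 < g' := by
    have : 0 < κ * (ρ - R) := mul_pos hκ (by linarith)
    linarith
  -- first order condition, from moving towards `x`
  have key1 : g' * L ≤ 1 := by
    apply le_of_forall_pos_le_add
    intro η hη
    set n := R⁻¹ • (ζ - x) with hn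
    have hn1 : ‖n‖ = 1 := by
      rw [hn, norm_smul, Real.norm_eq_abs, abs_of_pos (inv_pos.2 hR0)]
      exact inv_mul_cancel₀ hR0.ne'
    have hdir : ∀ w ∈ Ω \ K, ∀ᶠ τ : ℝ in nhdsWithin 0 (Ioi 0),
        v w - τ * ((1 + η) / L) ≤ v (w + τ • (-(‖Du w‖ * L)⁻¹ • n)) ∧
        w + τ • (-(‖Du w‖ * L)⁻¹ • n) ∈ Ω := by
      intro w hw
      have hw0 : 0 < ‖Du w‖ := norm_pos_iff.2 (H.ne_zero w hw)
      have h1 := eventually_le_of_hasFDerivWithinAt (h := -(‖Du w‖ * L)⁻¹ • n)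
        (k := -((1 + η) / L)) ((H.grad w hw).hasFDerivWithinAt_innerSL univ) (by simp) (by
          rw [inner_smul_right]
          have h2 := le_of_abs_le (abs_real_inner_le_norm (Du w) n)
          rw [hn1, mul_one] at h2
          have h3 : (‖Du w‖ * L)⁻¹ * ⟪Du w, n⟫ ≤ (‖Du w‖ * L)⁻¹ * ‖Du w‖ := by gcongr
          have h4 : (‖Du w‖ * L)⁻¹ * ‖Du w‖ = 1 / L := by field_simp
          have h5 : 1 / L < (1 + η) / L := by gcongr; linarith
          linarith)
      have h2 : ∀ᶠ τ : ℝ in nhdsWithin 0 (Ioi 0), w + τ • (-(‖Du w‖ * L)⁻¹ • n) ∈ Ω := by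
        apply nhdsWithin_le_nhds
        apply ContinuousAt.eventually_mem (by fun_prop)
        simpa using H.isOpen.mem_nhds hw.1
      filter_upwards [h1, h2] with τ h1 h2
      exact ⟨by linarith, h2⟩
    have hsm : ∀ᶠ τ : ℝ in nhdsWithin 0 (Ioi 0), τ < R := nhdsWithin_le_nhds (gt_mem_nhds hR0)
    obtain ⟨τ, ⟨⟨hy1, hz1⟩, hτR⟩, hτ⟩ :=
      (((hdir y hy).and (hdir z hz)).and hsm).and self_mem_nhdsWithin |>.exists
    have hτ : 0 < τ := hτ
    have e : lam • (y + τ • (-(p * L)⁻¹ • n)) + (1 - lam) • (z + τ • (-(q * L)⁻¹ • n)) - x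
        = (1 - τ * R⁻¹) • (ζ - x) := by
      have h1 : lam * (p * L)⁻¹ + (1 - lam) * (q * L)⁻¹ = 1 := by
        have : lam * (p * L)⁻¹ + (1 - lam) * (q * L)⁻¹ = L⁻¹ * L := by
          nth_rw 4 [hL]
          field_simp
        rw [this, inv_mul_cancel₀ hL0.ne']
      have h2 : lam • (y + τ • (-(p * L)⁻¹ • n)) + (1 - lam) • (z + τ • (-(q * L)⁻¹ • n)) - x
        = (ζ - x) - (τ * (lam * (p * L)⁻¹ + (1 - lam) * (q * L)⁻¹)) • n := by
        rw [hζ]; module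
      rw [h2, h1, hn]
      module
    have e2 : ‖(1 - τ * R⁻¹) • (ζ - x)‖ = R - τ := by
      have : 0 < 1 - τ * R⁻¹ := by
        rw [sub_pos, ← div_eq_mul_inv, div_lt_one hR0]; exact hτR
      rw [norm_smul, Real.norm_eq_abs, abs_of_pos this, ← hR]
      field_simp
    have h3 := hmax _ hy1.2 _ hz1.2 (by rw [e, e2]; linarith)
    rw [e, e2] at h3
    have h4 : v y - τ * ((1 + η) / L) ≤ min (v (y + τ • (-(p * L)⁻¹ • n)))
        (v (z + τ • (-(q * L)⁻¹ • n))) := le_min hy1.1 (by rw [hyz]; exact hz1.1)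
    have h5 : τ * g' ≤ τ * ((1 + η) / L) := by
      have : 0 ≤ κ * τ ^ 2 := by positivity
      rw [hg']
      linarith
    have h6 := le_of_mul_le_mul_left h5 hτ
    rwa [le_div_iff₀ hL0] at h6
  -- ascending step
  obtain ⟨t, ht, hty, htz, htR⟩ : ∃ t > 0, closedBall y (t / p) ⊆ Ω \ K ∧
      closedBall z (t / q) ⊆ Ω \ K ∧ R + t * L < ρ := by
    obtain ⟨r1, hr1, h1⟩ := nhds_basis_closedBall.mem_iff.1 (H.isOpen_ring.mem_nhds hy)
    obtain ⟨r2, hr2, h2⟩ := nhds_basis_closedBall.mem_iff.1 (H.isOpen_ring.mem_nhds hz)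
    refine ⟨min (min (r1 * p) (r2 * q)) ((ρ - R) / (2 * L)), ?_, ?_, ?_, ?_⟩
    · have : 0 < ρ - R := by linarith
      positivity
    · refine (closedBall_subset_closedBall ?_).trans h1
      rw [div_le_iff₀ hp0]
      exact (min_le_left _ _).trans (min_le_left _ _)
    · refine (closedBall_subset_closedBall ?_).trans h2
      rw [div_le_iff₀ hq0]
      exact (min_le_left _ _).trans (min_le_right _ _)
    · have : min (min (r1 * p) (r2 * q)) ((ρ - R) / (2 * L)) * L ≤ (ρ - R) / (2 * L) * L := by
        gcongr; exact min_le_right _ _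
      have e : (ρ - R) / (2 * L) * L = (ρ - R) / 2 := by field_simp
      linarith
  obtain ⟨y', hy', -, hvy⟩ := H.sub.exists_ge (by positivity) hty H.continuous.continuousOn (H.grad y hy)
  obtain ⟨z', hz', -, hvz⟩ := H.sub.exists_ge (by positivity) htz H.continuous.continuousOn (H.grad z hz)
  have e1 : p * (t / p) = t := by field_simp
  have e2 : q * (t / q) = t := by field_simp
  rw [← hp, e1] at hvy
  rw [← hq, e2] at hvz
  have hR1 : ‖lam • y' + (1 - lam) • z' - x‖ ≤ R + t * L := by
    have : lam • y' + (1 - lam) • z' - x = (ζ - x) + (lam • (y' - y) + (1 - lam) • (z' - z)) := by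
      rw [hζ]; module
    rw [this]
    refine (norm_add_le _ _).trans ?_
    gcongr
    refine (norm_add_le _ _).trans ?_
    rw [norm_smul, norm_smul, Real.norm_eq_abs, Real.norm_eq_abs, abs_of_nonneg hl0,
      abs_of_nonneg (by linarith)]
    rw [mem_closedBall, dist_eq_norm] at hy' hz'
    have e : t * L = lam * (t / p) + (1 - lam) * (t / q) := by rw [hL]; ring
    rw [e]
    have : 0 ≤ 1 - lam := by linarith
    gcongr
  have h3 := hmax y' (hty hy').1 z' (htz hz').1 (by linarith)
  have h4 : v y + t ≤ min (v y') (v z') := le_min hvy (by rw [hyz]; exact hvz)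
  set R1 := ‖lam • y' + (1 - lam) • z' - x‖
  have h5 : (s + 2 * κ * ρ) * R1 - κ * R1 ^ 2 ≤
      (s + 2 * κ * ρ) * (R + t * L) - κ * (R + t * L) ^ 2 := by
    have h6 : 0 ≤ (R + t * L - R1) * (s + κ * (2 * ρ - (R + t * L) - R1)) := by
      apply mul_nonneg (by linarith)
      have : 0 ≤ κ * (2 * ρ - (R + t * L) - R1) := mul_nonneg hκ.le (by linarith)
      linarith
    nlinarith
  have h6 : t ≤ t * (g' * L) - κ * (t * L) ^ 2 := by
    rw [hg']
    nlinarith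
  have h7 : 0 < κ * (t * L) ^ 2 := by positivity
  nlinarith

end IsPotential

/-- The point `λ y + (1 - λ) z` for `t = (y, z, λ)`. -/
def segPt (t : E2 × E2 × ℝ) : E2 := t.2.2 • t.1 + (1 - t.2.2) • t.2.1

/-- The triples `(y, z, λ)` with endpoints in the closure of `Ω` and `λ ∈ [0, 1]`. -/
def segs (Ω : Set E2) : Set (E2 × E2 × ℝ) := closure Ω ×ˢ closure Ω ×ˢ Icc 0 1

/-- The smaller of the two end values. -/
def endMin (v : E2 → ℝ) (t : E2 × E2 × ℝ) : ℝ := min (v t.1) (v t.2.1)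

lemma continuous_segPt : Continuous segPt := by unfold segPt; fun_prop

lemma segPt_swap (t : E2 × E2 × ℝ) : segPt (t.2.1, t.1, 1 - t.2.2) = segPt t := by
  unfold segPt; simp only; module

namespace IsPotential

variable {Ω K : Set E2} {v : E2 → ℝ} {Du : E2 → E2}

lemma isCompact_segs (H : IsPotential Ω K v Du) : IsCompact (segs Ω) :=
  H.isBounded.isCompact_closure.prod (H.isBounded.isCompact_closure.prod isCompact_Icc)

lemma segPt_mem (H : IsPotential Ω K v Du) {t : E2 × E2 × ℝ} (ht : t ∈ segs Ω) :
    segPt t ∈ closure Ω :=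
  H.convex.closure ht.1 ht.2.1 ht.2.2.1 (by linarith [ht.2.2.2]) (by ring)

lemma continuous_endMin (H : IsPotential Ω K v Du) : Continuous (endMin v) := by
  have := H.continuous
  unfold endMin; fun_prop

lemma exists_balanced_aux (H : IsPotential Ω K v Du) {t : E2 × E2 × ℝ} (ht : t ∈ segs Ω)
    (h1 : v t.2.1 ≤ v t.1) (h2 : v (segPt t) ≤ v t.2.1) :
    ∃ t' ∈ segs Ω, segPt t' = segPt t ∧ v t'.1 = v t.2.1 ∧ v t'.2.1 = v t.2.1 := by
  obtain ⟨y, z, l⟩ := t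
  obtain ⟨hy, hz, hl0, hl1⟩ := ht
  simp only at h1 h2 hy hz hl0 hl1 ⊢
  rcases hl0.eq_or_lt with h | hl0
  · refine ⟨(z, z, 0), ⟨hz, hz, by simp⟩, ?_, rfl, rfl⟩
    simp [segPt, ← h]
  set ζ := segPt (y, z, l) with hζ
  have hζm : ζ ∈ closure Ω := H.segPt_mem ⟨hy, hz, hl0.le, hl1⟩
  have hcont : Continuous (fun μ : ℝ => v (ζ + μ • (y - ζ))) := by
    have := H.continuous; fun_prop
  obtain ⟨μ, hμ, hμe⟩ := intermediate_value_Icc (zero_le_one' ℝ) hcont.continuousOn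
    (show v z ∈ Icc _ _ by constructor <;> simpa)
  have hd : 0 < l + μ * (1 - l) := by
    have : 0 ≤ μ * (1 - l) := mul_nonneg hμ.1 (by linarith)
    linarith
  refine ⟨(ζ + μ • (y - ζ), z, l / (l + μ * (1 - l))), ⟨?_, hz, ?_, ?_⟩, ?_, hμe, rfl⟩
  · have := H.convex.closure hζm hy (a := 1 - μ) (b := μ) (by linarith [hμ.2]) hμ.1 (by ring)
    simp only
    convert this using 1
    module
  · simp only; positivity
  · simp only
    rw [div_le_one hd]
    have : 0 ≤ μ * (1 - l) := mul_nonneg hμ.1 (by linarith)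
    linarith
  · have e : ζ + μ • (y - ζ) = z + (l + μ * (1 - l)) • (y - z) := by
      rw [hζ]; simp only [segPt]; module
    rw [segPt]
    simp only
    rw [e]
    have e2 : (l / (l + μ * (1 - l))) • (z + (l + μ * (1 - l)) • (y - z)) +
      (1 - l / (l + μ * (1 - l))) • z = z + (l / (l + μ * (1 - l)) * (l + μ * (1 - l))) • (y - z) := by
      module
    rw [e2, div_mul_cancel₀ _ hd.ne', hζ]
    simp only [segPt]
    module

lemma exists_balanced (H : IsPotential Ω K v Du) {t : E2 × E2 × ℝ} (ht : t ∈ segs Ω)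
    (h : v (segPt t) ≤ endMin v t) :
    ∃ t' ∈ segs Ω, segPt t' = segPt t ∧ v t'.1 = endMin v t ∧ v t'.2.1 = endMin v t := by
  rcases le_total (v t.2.1) (v t.1) with h1 | h1
  · rw [endMin, min_eq_right h1] at h ⊢
    exact H.exists_balanced_aux ht h1 h
  · rw [endMin, min_eq_left h1] at h ⊢
    have h3 := H.exists_balanced_aux (t := (t.2.1, t.1, 1 - t.2.2))
      ⟨ht.2.1, ht.1, by simpa using ht.2.2.2, by simpa using ht.2.2.1⟩ h1 (by rwa [segPt_swap])
    rwa [segPt_swap] at h3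

/-- The quasiconcave envelope of `v` satisfies the midpoint inequality of a subsolution. -/
lemma endMin_midpoint (H : IsPotential Ω K v Du) {x : E2} {ρ A M : ℝ} (hρ : 0 < ρ)
    (hG : closedBall x ρ ⊆ Ω \ K)
    (hA : ∀ t ∈ segs Ω, segPt t = x → endMin v t ≤ A) (hAM : A ≤ M)
    (hM : ∀ t ∈ segs Ω, segPt t ∈ closedBall x ρ → endMin v t ≤ M)
    {t : E2 × E2 × ℝ} (ht : t ∈ segs Ω) (htx : ‖segPt t - x‖ ≤ ρ / 2) :
    2 * endMin v t ≤ A + M := by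
  by_contra! hlt
  have hxG := hG (mem_closedBall_self hρ.le)
  have hself : ∀ y ∈ closure Ω, ((y, y, 0) : E2 × E2 × ℝ) ∈ segs Ω := fun y hy =>
    ⟨hy, hy, by simp⟩
  have hA0 : 0 ≤ A := by
    have := hA (x, x, 0) (hself x (subset_closure hxG.1)) (by simp [segPt])
    simp only [endMin, min_self] at this
    linarith [H.nonneg x]
  set s := (M - A) / ρ with hs
  have hs0 : 0 ≤ s := div_nonneg (by linarith) hρ.le
  have hsρ : s * ρ = M - A := by rw [hs]; field_simp
  obtain ⟨κ, hκ, hκ2⟩ : ∃ κ > 0, κ * (ρ * ρ) < endMin v t - (A + M) / 2 := by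
    refine ⟨(endMin v t - (A + M) / 2) / (2 * ρ * ρ), by
      apply div_pos (by linarith) (by positivity), ?_⟩
    have : 0 < endMin v t - (A + M) / 2 := by linarith
    field_simp
    linarith
  set g := fun R : ℝ => (s + 2 * κ * ρ) * R - κ * R ^ 2 with hg
  have hcomp : IsCompact (segs Ω ∩ segPt ⁻¹' closedBall x ρ) :=
    H.isCompact_segs.inter_right (isClosed_closedBall.preimage continuous_segPt)
  have hcont : Continuous (fun t => endMin v t - g ‖segPt t - x‖) := by
    have := H.continuous_endMin
    have := continuous_segPt
    simp only [hg]
    fun_prop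
  have htm : t ∈ segs Ω ∩ segPt ⁻¹' closedBall x ρ :=
    ⟨ht, by rw [mem_preimage, mem_closedBall, dist_eq_norm]; linarith⟩
  obtain ⟨t₀, ⟨ht₀, ht₀b⟩, hmax⟩ := hcomp.exists_isMaxOn ⟨t, htm⟩ hcont.continuousOn
  have hmax' : ∀ t' ∈ segs Ω, ‖segPt t' - x‖ ≤ ρ →
      endMin v t' - g ‖segPt t' - x‖ ≤ endMin v t₀ - g ‖segPt t₀ - x‖ := fun t' h1 h2 =>
    hmax ⟨h1, by rwa [mem_preimage, mem_closedBall, dist_eq_norm]⟩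
  have hpos : A < endMin v t₀ - g ‖segPt t₀ - x‖ := by
    refine lt_of_lt_of_le ?_ (hmax' t ht (by linarith))
    have h0 := norm_nonneg (segPt t - x)
    have h1 : s * ‖segPt t - x‖ ≤ s * (ρ / 2) := by gcongr
    have h2 : 2 * κ * ρ * ‖segPt t - x‖ ≤ 2 * κ * ρ * (ρ / 2) := by gcongr
    have h3 : 0 ≤ κ * ‖segPt t - x‖ ^ 2 := by positivity
    simp only [hg]
    linarith
  have hRρ : ‖segPt t₀ - x‖ < ρ := by
    have h1 : ‖segPt t₀ - x‖ ≤ ρ := by simpa [dist_eq_norm] using ht₀b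
    refine lt_of_le_of_ne h1 fun h => ?_
    have h2 := hM t₀ ht₀ ht₀b
    rw [h] at hpos
    have : 0 < κ * ρ ^ 2 := by positivity
    simp only [hg] at hpos
    linarith
  have hR0 : 0 < ‖segPt t₀ - x‖ := by
    refine lt_of_le_of_ne (norm_nonneg _) fun h => ?_
    have h2 := hA t₀ ht₀ (by rw [← sub_eq_zero, ← norm_eq_zero, ← h])
    rw [← h] at hpos
    simp only [hg] at hpos
    linarith
  have hg0 : 0 ≤ g ‖segPt t₀ - x‖ := by
    have h1 : 0 ≤ s * ‖segPt t₀ - x‖ := by positivity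
    have h2 : 0 ≤ κ * (‖segPt t₀ - x‖ * (2 * ρ - ‖segPt t₀ - x‖)) :=
      mul_nonneg hκ.le (mul_nonneg hR0.le (by linarith))
    simp only [hg]
    linarith
  have hle : v (segPt t₀) ≤ endMin v t₀ := by
    have h1 := hmax' (segPt t₀, segPt t₀, 0) (hself _ (H.segPt_mem ht₀))
    have e : segPt (segPt t₀, segPt t₀, 0) = segPt t₀ := by simp [segPt]
    rw [e] at h1
    have h2 := h1 hRρ.le
    simp only [endMin, min_self] at h2 ⊢
    linarith
  obtain ⟨t₁, ht₁, he, hv1, hv2⟩ := H.exists_balanced ht₀ hle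
  have hc1 : endMin v t₀ < 1 := by
    refine lt_of_le_of_ne (by rw [← hv1]; exact H.le_one _) fun h => ?_
    have h1 := H.mem_of_eq_one (hv1.trans h)
    have h2 := H.mem_of_eq_one (hv2.trans h)
    have h3 : segPt t₁ ∈ K := H.convexK h1 h2 ht₁.2.2.1 (by linarith [ht₁.2.2.2]) (by ring)
    exact (hG (he ▸ ht₀b)).2 h3
  have hc0 : 0 < endMin v t₀ := by linarith
  obtain ⟨y, z, l⟩ := t₁
  simp only at hv1 hv2
  have hy : y ∈ Ω \ K := H.mem_ring (by rw [hv1]; exact hc0) (by rw [hv1]; exact hc1)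
  have hz : z ∈ Ω \ K := H.mem_ring (by rw [hv2]; exact hc0) (by rw [hv2]; exact hc1)
  have he : l • y + (1 - l) • z = segPt t₀ := he
  refine H.not_touching (lam := l) (x := x) (ρ := ρ) (s := s) hy hz (hv1.trans hv2.symm)
    ht₁.2.2.1 ht₁.2.2.2 hs0 hκ
    (by rwa [he]) (by rwa [he]) ?_
  intro y' hy' z' hz' hle'
  have := hmax' (y', z', l) ⟨subset_closure hy', subset_closure hz', ht₁.2.2⟩ hle'
  rw [he, hv1]
  exact this

/-- The potential is quasiconcave. -/
theorem endMin_le (H : IsPotential Ω K v Du) {t : E2 × E2 × ℝ} (ht : t ∈ segs Ω) :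
    endMin v t ≤ v (segPt t) := by
  by_contra! hlt
  set m₀ := endMin v t - v (segPt t) with hm₀
  have hm₀0 : 0 < m₀ := by linarith
  have hcs : HasCompactSupport v :=
    HasCompactSupport.intro H.isBounded.isCompact_closure fun x hx =>
      H.eq_zero x fun h => hx (subset_closure h)
  obtain ⟨δ, hδ, hunif⟩ := Metric.uniformContinuous_iff.1
    (hcs.uniformContinuous_of_continuous H.continuous) m₀ hm₀0
  obtain ⟨ε, hε0, hεδ, hε1⟩ : ∃ ε > 0, 8 * ε ≤ δ ∧ 2 * ε ≤ 1 :=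
    ⟨min (δ / 8) (1 / 2), by positivity, by linarith [min_le_left (δ / 8) (1 / 2 : ℝ)],
      by linarith [min_le_right (δ / 8) (1 / 2 : ℝ)]⟩
  set C : Set ((E2 × E2 × ℝ) × E2) :=
    (segs Ω ×ˢ cthickening 1 (closure Ω)) ∩ {τ | ‖segPt τ.1 - τ.2‖ ≤ 2 * ε} with hC
  have hCc : IsCompact C := by
    apply IsCompact.inter_right
    · exact H.isCompact_segs.prod (H.isBounded.isCompact_closure.cthickening)
    · have := continuous_segPt
      exact isClosed_le (by fun_prop) continuous_const
  have hCm : ∀ τ₁ τ₂, τ₁ ∈ segs Ω → ‖segPt τ₁ - τ₂‖ ≤ 2 * ε → (τ₁, τ₂) ∈ C := by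
    intro τ₁ τ₂ h1 h2
    refine ⟨⟨h1, ?_⟩, h2⟩
    apply mem_cthickening_of_dist_le τ₂ (segPt τ₁) 1 _ (H.segPt_mem h1)
    rw [dist_comm, dist_eq_norm]
    linarith
  have hv := H.continuous
  have hq := H.continuous_endMin
  have hf : Continuous (fun τ : (E2 × E2 × ℝ) × E2 => endMin v τ.1 - v τ.2) := by fun_prop
  have htC : (t, segPt t) ∈ C := hCm t _ ht (by simp [hε0.le])
  obtain ⟨τ₀, hτ₀, hmax₀⟩ := hCc.exists_isMaxOn ⟨_, htC⟩ hf.continuousOn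
  set m := endMin v τ₀.1 - v τ₀.2 with hm
  have hmm₀ : m₀ ≤ m := hmax₀ htC
  have hmax : ∀ τ₁ τ₂, τ₁ ∈ segs Ω → ‖segPt τ₁ - τ₂‖ ≤ 2 * ε → endMin v τ₁ - v τ₂ ≤ m :=
    fun τ₁ τ₂ h1 h2 => hmax₀ (hCm τ₁ τ₂ h1 h2)
  obtain ⟨⟨t₁, x'⟩, ⟨ht₁C, ht₁m⟩, hmax₁⟩ :=
    (hCc.inter_right (isClosed_singleton (x := m) |>.preimage hf)).exists_isMaxOn
      ⟨τ₀, hτ₀, rfl⟩ (f := fun τ => v τ.2) (by fun_prop)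
  have ht₁m : endMin v t₁ - v x' = m := ht₁m
  have ht₁ : t₁ ∈ segs Ω := ht₁C.1.1
  have hx' : ‖segPt t₁ - x'‖ ≤ 2 * ε := ht₁C.2
  have hballΩ : ∀ z, dist z (segPt t₁) < δ → z ∈ Ω := by
    intro z hz
    have h0 : ∀ y, m₀ ≤ v y → y + (z - segPt t₁) ∈ Ω := by
      intro y hy
      apply H.mem_of_pos
      have := hunif (a := y + (z - segPt t₁)) (b := y) (by simpa [dist_eq_norm] using hz)
      rw [Real.dist_eq, abs_lt] at this
      linarith
    have h1 : m₀ ≤ endMin v t₁ := by linarith [H.nonneg x']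
    have := H.convex (h0 t₁.1 (h1.trans (min_le_left _ _))) (h0 t₁.2.1 (h1.trans (min_le_right _ _)))
      ht₁.2.2.1 (show 0 ≤ 1 - t₁.2.2 by linarith [ht₁.2.2.2]) (by ring)
    convert this using 1
    simp only [segPt]
    module
  have hballK : ∀ z, dist z x' < δ → z ∉ K := by
    intro z hz hK
    have := hunif (a := z) (b := x') hz
    rw [H.eq_one z hK, Real.dist_eq, abs_lt] at this
    have h1 : endMin v t₁ ≤ 1 := (min_le_left _ _).trans (H.le_one _)
    linarith
  set x := (1 / 2 : ℝ) • (segPt t₁ + x') with hx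
  have hxx' : ‖x - x'‖ ≤ ε := by
    have : x - x' = (1 / 2 : ℝ) • (segPt t₁ - x') := by rw [hx]; module
    rw [this, norm_smul, Real.norm_eq_abs, abs_of_pos (by norm_num)]
    linarith
  have hxt : ‖segPt t₁ - x‖ ≤ ε := by
    have : segPt t₁ - x = (1 / 2 : ℝ) • (segPt t₁ - x') := by rw [hx]; module
    rw [this, norm_smul, Real.norm_eq_abs, abs_of_pos (by norm_num)]
    linarith
  have hG : closedBall x (2 * ε) ⊆ Ω \ K := by
    intro z hz
    rw [mem_closedBall] at hz
    constructor
    · apply hballΩ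
      have := dist_triangle z x (segPt t₁)
      rw [dist_comm x, dist_eq_norm (segPt t₁) x] at this
      linarith
    · apply hballK
      have := dist_triangle z x x'
      rw [dist_eq_norm x x'] at this
      linarith
  have hxG := hG (mem_closedBall_self (by positivity))
  have hxs : ((x, x, 0) : E2 × E2 × ℝ) ∈ segs Ω :=
    ⟨subset_closure hxG.1, subset_closure hxG.1, by simp⟩
  have hsx : segPt (x, x, 0) = x := by simp [segPt]
  obtain ⟨tA, ⟨htA, htAx⟩, hA⟩ :=
    (H.isCompact_segs.inter_right (isClosed_singleton (x := x) |>.preimage continuous_segPt)).exists_isMaxOn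
      ⟨_, hxs, hsx⟩ hq.continuousOn
  obtain ⟨tM, ⟨htM, htMx⟩, hM⟩ :=
    (H.isCompact_segs.inter_right (isClosed_closedBall (x := x) (ε := 2 * ε)
      |>.preimage continuous_segPt)).exists_isMaxOn
      ⟨_, hxs, by rw [mem_preimage, hsx]; exact mem_closedBall_self (by positivity)⟩ hq.continuousOn
  obtain ⟨w, hw, hwmin⟩ := (isCompact_closedBall x (2 * ε)).exists_isMinOn
    ⟨x, mem_closedBall_self (by positivity)⟩ hv.continuousOn
  have htAx : segPt tA = x := htAx
  have h1 : endMin v tA - v w ≤ m := hmax _ _ htA (by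
    rw [htAx, ← dist_eq_norm, dist_comm]; exact hw)
  have htMx' : ‖segPt tM - x‖ ≤ 2 * ε := by rw [← dist_eq_norm]; exact htMx
  have h2 : endMin v tM - v x ≤ m := hmax _ _ htM htMx'
  have h3 : 2 * endMin v t₁ ≤ endMin v tA + endMin v tM :=
    H.endMin_midpoint (ρ := 2 * ε) (by positivity) hG (fun t h h' => hA ⟨h, h'⟩)
      (hM ⟨htA, by rw [mem_preimage, htAx]; exact mem_closedBall_self (by positivity)⟩)
      (fun t h h' => hM ⟨h, h'⟩) ht₁ (by linarith)
  have h4 : v x + v w ≤ 2 * v x' := by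
    have h5 := H.super.le_cone (ρ := 2 * ε) (M := -v w) (by positivity) hG hv.neg.continuousOn
      (fun ζ hζ => neg_le_neg (hwmin hζ)) (ζ := x')
      (by rw [mem_closedBall, dist_comm, dist_eq_norm]; linarith)
    have h6 : v w ≤ v x := hwmin (mem_closedBall_self (by positivity))
    have h7 : (-v w - -v x) / (2 * ε) * ‖x' - x‖ ≤ (-v w - -v x) / (2 * ε) * ε := by
      rw [norm_sub_rev]
      apply mul_le_mul_of_nonneg_left hxx'
      apply div_nonneg _ (by positivity)
      linarith
    have h8 : (-v w - -v x) / (2 * ε) * ε = (v x - v w) / 2 := by field_simp; ring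
    linarith
  have h5 : v x ≤ v x' := hmax₁ (a := (tM, x)) ⟨hCm _ _ htM htMx', by
    change endMin v tM - v x = m
    linarith⟩
  apply H.not_isLocalMin hxG
  filter_upwards [ball_mem_nhds x hε0] with z hz
  have h6 := hmax t₁ z ht₁ (by
    have := norm_sub_le_norm_sub_add_norm_sub (segPt t₁) x z
    rw [mem_ball, dist_comm, dist_eq_norm] at hz
    linarith)
  linarith

end IsPotential

lemma lapInf_neg (φ : E2 → ℝ) (x : E2) : lapInf (fun y => -φ y) x = -lapInf φ x := by
  have h : gradient (fun y => -φ y) = fun y => -gradient φ y := by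
    ext1 y
    have : fderiv ℝ (fun y => -φ y) y = -fderiv ℝ φ y := fderiv_neg
    simp only [gradient]
    rw [this, map_neg]
  have h2 : fderiv ℝ (fun y => -gradient φ y) x = -fderiv ℝ (gradient φ) x := fderiv_neg
  unfold lapInf
  rw [h, h2]
  simp

/-- An ∞-potential of a convex ring extends to the plane by `1` on `K` and `0` off `Ω`. -/
lemma exists_isPotential {Ω K : Set E2} {u : E2 → ℝ} {Du : E2 → E2}
    (hΩo : IsOpen Ω) (hΩb : Bornology.IsBounded Ω) (hΩconv : Convex ℝ Ω)
    (hKcp : IsCompact K) (hKconv : Convex ℝ K) (hKΩ : K ⊆ Ω)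
    (hu_cont : ContinuousOn u (closure (Ω \ K)))
    (hu0 : ∀ x ∈ frontier Ω, u x = 0) (hu1 : ∀ x ∈ frontier K, u x = 1)
    (hDu : ∀ x ∈ Ω \ K, HasGradientAt u (Du x) x) (hDu_ne : ∀ x ∈ Ω \ K, Du x ≠ 0)
    (hvisc : ViscosityInftyHarmonic u (Ω \ K)) :
    ∃ v : E2 → ℝ, IsPotential Ω K v Du ∧ ∀ x ∈ closure Ω \ K, v x = u x := by
  set G := Ω \ K with hG
  have hGo : IsOpen G := hΩo.sdiff hKcp.isClosed
  set v : E2 → ℝ := fun x => if x ∈ K then 1 else if x ∈ Ω then u x else 0 with hv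
  have v1 : ∀ x ∈ K, v x = 1 := fun x hx => by simp [hv, hx]
  have v0 : ∀ x, x ∉ Ω → v x = 0 := fun x hx => by
    simpa [hv, hx] using fun h => hx (hKΩ h)
  have vu : ∀ x ∈ G, v x = u x := fun x hx => by simp [hv, hx.1, hx.2]
  have vf : ∀ x ∈ frontier Ω, v x = u x := fun x hx => by
    rw [hu0 x hx, v0]
    rw [hΩo.frontier_eq] at hx
    exact hx.2
  have vcG : ∀ x ∈ closure G, v x = u x := by
    intro x hx
    by_cases hK : x ∈ K
    · rw [v1 x hK, hu1]
      rw [frontier_eq_closure_inter_closure]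
      exact ⟨subset_closure hK, closure_mono (fun y hy => hy.2) hx⟩
    · by_cases hO : x ∈ Ω
      · exact vu x ⟨hO, hK⟩
      · apply vf
        rw [hΩo.frontier_eq]
        exact ⟨closure_mono sdiff_subset hx, hO⟩
  have hcont : Continuous v := by
    have h1 : ContinuousOn v K := (continuousOn_const (c := (1 : ℝ))).congr v1
    have h2 : ContinuousOn v (closure G) := hu_cont.congr vcG
    have h3 : ContinuousOn v Ωᶜ := (continuousOn_const (c := (0 : ℝ))).congr v0
    have h4 := (h1.union_of_isClosed h2 hKcp.isClosed isClosed_closure).union_of_isClosed h3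
      (hKcp.isClosed.union isClosed_closure) hΩo.isClosed_compl
    rw [← continuousOn_univ]
    refine h4.mono fun x _ => ?_
    by_cases hO : x ∈ Ω
    · by_cases hK : x ∈ K
      · exact Or.inl (Or.inl hK)
      · exact Or.inl (Or.inr (subset_closure ⟨hO, hK⟩))
    · exact Or.inr hO
  have hev : ∀ x ∈ G, v =ᶠ[nhds x] u := fun x hx => by
    filter_upwards [hGo.mem_nhds hx] with y hy using vu y hy
  have hgrad : ∀ x ∈ G, HasGradientAt v (Du x) x := fun x hx => by
    have := hDu x hx
    rw [hasGradientAt_iff_hasFDerivAt] at this ⊢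
    exact this.congr_of_eventuallyEq (hev x hx)
  have hext : ∀ x ∈ G, ¬ IsLocalExtr v x := by
    intro x hx h
    have := h.hasFDerivAt_eq_zero (hasGradientAt_iff_hasFDerivAt.1 (hgrad x hx))
    exact hDu_ne x hx ((map_eq_zero_iff _ (InnerProductSpace.toDual ℝ E2).injective).1 this)
  have hcΩ : IsCompact (closure Ω) := hΩb.isCompact_closure
  have hnhds : ∀ x ∈ G, closure Ω ∈ nhds x := fun x hx =>
    mem_of_superset (hΩo.mem_nhds hx.1) subset_closure
  have hpos : ∀ x ∈ G, 0 < v x := by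
    intro x hx
    by_contra! hle
    obtain ⟨y, hy, hmin⟩ := hcΩ.exists_isMinOn ⟨x, subset_closure hx.1⟩ hcont.continuousOn
    have hyx : v y ≤ v x := hmin (subset_closure hx.1)
    by_cases hK : y ∈ K
    · rw [v1 y hK] at hyx; linarith
    by_cases hO : y ∈ Ω
    · exact hext y ⟨hO, hK⟩ (Or.inl (hmin.isLocalMin (hnhds y ⟨hO, hK⟩)))
    · refine hext x hx (Or.inl ?_)
      filter_upwards [hnhds x hx] with z hz
      have : v y ≤ v z := hmin hz
      rw [v0 y hO] at this
      linarith
  have hlt : ∀ x ∈ G, v x < 1 := by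
    intro x hx
    by_contra! hle
    obtain ⟨y, hy, hmax⟩ := hcΩ.exists_isMaxOn ⟨x, subset_closure hx.1⟩ hcont.continuousOn
    have hyx : v x ≤ v y := hmax (subset_closure hx.1)
    by_cases hO : y ∈ Ω
    swap
    · rw [v0 y hO] at hyx; linarith
    by_cases hK : y ∈ K
    · refine hext x hx (Or.inr ?_)
      filter_upwards [hnhds x hx] with z hz
      have : v z ≤ v y := hmax hz
      rw [v1 y hK] at this
      linarith
    · exact hext y ⟨hO, hK⟩ (Or.inr (hmax.isLocalMax (hnhds y ⟨hO, hK⟩)))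
  refine ⟨v, ⟨hΩo, hΩb, hΩconv, hKcp, hKconv, hKΩ, hcont, v1, v0, hpos, hlt, hgrad, hDu_ne,
    ?_, ?_⟩, ?_⟩
  · intro x hx φ hφ hmax
    refine (hvisc x hx φ hφ).1 (hmax.congr ?_)
    filter_upwards [hev x hx] with y hy
    rw [hy]
  · intro x hx φ hφ hmax
    have h1 := (hvisc x hx (fun y => -φ y) hφ.neg).2 ?_
    · rw [lapInf_neg] at h1; linarith
    · have h2 : IsLocalMin (fun y => -(-v y - φ y)) x := hmax.neg
      refine h2.congr ?_
      filter_upwards [hev x hx] with y hy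
      rw [hy]; ring
  · intro x hx
    by_cases hO : x ∈ Ω
    · exact vu x ⟨hO, hx.2⟩
    · apply vf
      rw [hΩo.frontier_eq]
      exact ⟨hx.1, hO⟩

/-- The radial projection onto the unit circle around `k`. -/
def radial (k x : E2) : E2 := ‖x - k‖⁻¹ • (x - k)

/-- The properties of the ∞-potential used for the level-set geometry; `v` is negative exactly
off `closure Ω`, and `k` is a point of `K`. -/
structure IsLevelFun (Ω K : Set E2) (k : E2) (v : E2 → ℝ) (Du : E2 → E2) : Prop where
  isOpen : IsOpen Ω
  isBounded : Bornology.IsBounded Ω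
  isClosed : IsClosed K
  mem : k ∈ K
  subset : K ⊆ Ω
  continuous : Continuous v
  nonneg_iff : ∀ x, 0 ≤ v x ↔ x ∈ closure Ω
  mem_of_pos : ∀ x, 0 < v x → x ∈ Ω
  eq_one : ∀ x ∈ K, v x = 1
  lt_one : ∀ x ∉ K, v x < 1
  continuousOn_grad : ContinuousOn Du (closure Ω \ K)
  ne_zero : ∀ x ∈ Ω \ K, Du x ≠ 0
  hasFDerivWithinAt : ∀ x ∈ closure Ω \ K,
    HasFDerivWithinAt v (innerSL ℝ (Du x)) (closure Ω) x
  inner_nonneg : ∀ x ∈ closure Ω \ K, ∀ z, v x ≤ v z → 0 ≤ ⟪Du x, z - x⟫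
  eq_of_radial_eq : ∀ x y, 0 ≤ v x → v x < 1 → v x = v y → radial k x = radial k y → x = y
  exists_descent : ∀ x r, 0 < r → closedBall x r ⊆ Ω \ K →
    ∃ y ∈ closedBall x r, (∀ ζ ∈ closedBall x r, v y ≤ v ζ) ∧ v y ≤ v x - ‖Du x‖ * r ∧
      ‖Du x‖ ≤ ‖Du y‖

namespace IsPotential

variable {Ω K : Set E2} {v : E2 → ℝ} {Du : E2 → E2}

lemma hasFDerivWithinAt (H : IsPotential Ω K v Du) (hc : ContinuousOn Du (closure Ω \ K))
    {x : E2} (hx : x ∈ closure Ω \ K) :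
    HasFDerivWithinAt v (innerSL ℝ (Du x)) (closure Ω) x := by
  obtain ⟨r, hr, hrK⟩ := Metric.isOpen_iff.1 H.isCompact.isClosed.isOpen_compl x hx.2
  set s := Ω ∩ ball x r with hs
  have hsG : s ⊆ Ω \ K := fun y hy => ⟨hy.1, hrK hy.2⟩
  have hfd : ∀ y ∈ s, HasFDerivAt v (innerSL ℝ (Du y)) y := fun y hy =>
    (hasGradientAt_iff_hasFDerivAt.1 (H.grad y (hsG hy)))
  have h := hasFDerivWithinAt_closure_of_tendsto_fderiv (f := v) (s := s) (x := x)
    (f' := innerSL ℝ (Du x))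
    (fun y hy => (hfd y hy).differentiableAt.differentiableWithinAt)
    (H.convex.inter (convex_ball x r)) (H.isOpen.inter isOpen_ball)
    (fun y _ => H.continuous.continuousWithinAt) ?_
  · refine h.mono_of_mem_nhdsWithin ?_
    have h1 : closure Ω ∩ ball x r ⊆ closure s := isOpen_ball.closure_inter
    refine mem_of_superset ?_ h1
    exact inter_mem self_mem_nhdsWithin (mem_nhdsWithin_of_mem_nhds (ball_mem_nhds x hr))
  · have h1 : Tendsto Du (nhdsWithin x s) (nhds (Du x)) :=
      (hc x hx).mono_left (nhdsWithin_mono _ fun y hy =>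
        ⟨subset_closure (hsG hy).1, (hsG hy).2⟩)
    have h2 : Tendsto (fun y => innerSL ℝ (Du y)) (nhdsWithin x s) (nhds (innerSL ℝ (Du x))) :=
      ((innerSL ℝ (E := E2)).continuous.tendsto _).comp h1
    refine h2.congr' ?_
    filter_upwards [self_mem_nhdsWithin] with y hy using (hfd y hy).fderiv.symm

lemma inner_nonneg (H : IsPotential Ω K v Du) (hc : ContinuousOn Du (closure Ω \ K))
    {x z : E2} (hx : x ∈ closure Ω \ K) (hz : z ∈ closure Ω) (hxz : v x ≤ v z) :
    0 ≤ ⟪Du x, z - x⟫ := by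
  have h1 : HasFDerivWithinAt (fun y => -v y) (innerSL ℝ (-Du x)) (closure Ω) x := by
    rw [map_neg]
    exact (H.hasFDerivWithinAt hc hx).neg
  have h2 := inner_le_of_le (h := z - x) (k := 0) h1 ?_
  · rw [inner_neg_left] at h2; linarith
  · have : ∀ᶠ τ : ℝ in nhdsWithin 0 (Ioi 0), τ < 1 :=
      nhdsWithin_le_nhds (gt_mem_nhds one_pos)
    filter_upwards [this, self_mem_nhdsWithin] with τ h3 h4
    have h4 : 0 < τ := h4
    have ht : ((z, x, τ) : E2 × E2 × ℝ) ∈ segs Ω := ⟨hz, hx.1, h4.le, h3.le⟩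
    have e : segPt (z, x, τ) = x + τ • (z - x) := by unfold segPt; simp only; module
    have h5 := H.segPt_mem ht
    have h6 := H.endMin_le ht
    rw [e] at h5 h6
    rw [endMin, min_eq_right hxz] at h6
    exact ⟨h5, by linarith⟩

lemma ne_of_lineMap (H : IsPotential Ω K v Du) {k x : E2} {s : ℝ} (hk : k ∈ K)
    (hx : x ∈ closure Ω \ K) (hs0 : 0 < s) (hs1 : s < 1) (hv : v (k + s • (x - k)) = v x) :
    False := by
  set y := k + s • (x - k) with hy
  have hlt : v x < 1 := by
    rcases (H.le_one x).lt_or_eq with h | h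
    · exact h
    · exact absurd (H.mem_of_eq_one h) hx.2
  have hyΩ : y ∈ Ω := by
    have := H.convex.openSegment_interior_closure_subset_interior
      (H.isOpen.interior_eq.symm ▸ H.subset hk) hx.1
    rw [H.isOpen.interior_eq] at this
    refine this ⟨1 - s, s, by linarith, hs0, by ring, ?_⟩
    rw [hy]; module
  have hyG : y ∈ Ω \ K := ⟨hyΩ, fun h => by rw [H.eq_one y h] at hv; linarith⟩
  refine H.not_isLocalMin hyG ?_
  have hs : 0 < 1 - s := by linarith
  have hc : Continuous fun y' : E2 => k + (1 - s)⁻¹ • (y' - y) := by fun_prop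
  have e : k + (1 - s)⁻¹ • (y - y) = k := by simp
  have hn : {z | z ∈ Ω ∧ v x < v z} ∈ nhds (k + (1 - s)⁻¹ • (y - y)) := by
    rw [e]
    refine inter_mem (H.isOpen.mem_nhds (H.subset hk)) ?_
    exact (isOpen_lt continuous_const H.continuous).mem_nhds (by
      show v x < v k
      rw [H.eq_one k hk]; exact hlt)
  filter_upwards [hc.continuousAt.preimage_mem_nhds hn] with y' hy'
  obtain ⟨h1, h2⟩ := hy'
  have h3 := H.endMin_le (t := (x, k + (1 - s)⁻¹ • (y' - y), s))
    ⟨hx.1, subset_closure h1, hs0.le, hs1.le⟩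
  have e2 : segPt (x, k + (1 - s)⁻¹ • (y' - y), s) = y' := by
    unfold segPt
    simp only
    rw [smul_add, smul_smul, mul_inv_cancel₀ hs.ne', hy]
    module
  rw [e2, endMin, min_eq_left h2.le] at h3
  rw [hv]; exact h3

lemma isLevelFun (H : IsPotential Ω K v Du) (hc : ContinuousOn Du (closure Ω \ K)) {k : E2}
    (hk : k ∈ K) :
    IsLevelFun Ω K k (fun x => v x - infDist x (closure Ω)) Du := by
  have hΩne : (closure Ω).Nonempty := ⟨k, subset_closure (H.subset hk)⟩
  have hin : ∀ x ∈ closure Ω, v x - infDist x (closure Ω) = v x := fun x hx => by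
    rw [infDist_zero_of_mem hx, sub_zero]
  have hnn : ∀ x, 0 ≤ v x - infDist x (closure Ω) ↔ x ∈ closure Ω := by
    intro x
    constructor
    · intro h
      by_contra hx
      have h1 : 0 < infDist x (closure Ω) :=
        (isClosed_closure.notMem_iff_infDist_pos hΩne).1 hx
      rw [H.eq_zero x fun h' => hx (subset_closure h')] at h
      linarith
    · intro h
      rw [hin x h]; exact H.nonneg x
  have hle : ∀ x, v x - infDist x (closure Ω) ≤ v x := fun x => by
    linarith [infDist_nonneg (x := x) (s := closure Ω)]
  have hlt : ∀ x ∉ K, v x - infDist x (closure Ω) < 1 := fun x hx =>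
    (hle x).trans_lt ((H.le_one x).lt_of_ne fun h => hx (H.mem_of_eq_one h))
  have h1 : ∀ x ∈ K, v x - infDist x (closure Ω) = 1 := fun x hx => by
    rw [hin x (subset_closure (H.subset hx)), H.eq_one x hx]
  refine ⟨H.isOpen, H.isBounded, H.isCompact.isClosed, hk, H.subset,
    H.continuous.sub (continuous_infDist_pt _), hnn, fun x hx => H.mem_of_pos (hx.trans_le (hle x)),
    h1, hlt, hc, H.ne_zero, ?_, ?_, ?_, ?_⟩
  · intro x hx
    exact (H.hasFDerivWithinAt hc hx).congr hin (hin x hx.1)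
  · intro x hx z hxz
    have hz : z ∈ closure Ω := (hnn z).1 (((hnn x).2 hx.1).trans hxz)
    rw [hin x hx.1, hin z hz] at hxz
    exact H.inner_nonneg hc hx hz hxz
  · intro x y hx hx1 hxy hr
    have hxΩ := (hnn x).1 hx
    have hyΩ := (hnn y).1 (hxy ▸ hx)
    have hxK : x ∉ K := fun h => hx1.ne (h1 x h)
    have hyK : y ∉ K := fun h => (hxy ▸ hx1).ne (h1 y h)
    rw [hin x hxΩ, hin y hyΩ] at hxy
    have hnx : 0 < ‖x - k‖ := norm_pos_iff.2 (sub_ne_zero.2 fun h => hxK (h ▸ hk))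
    have hny : 0 < ‖y - k‖ := norm_pos_iff.2 (sub_ne_zero.2 fun h => hyK (h ▸ hk))
    have key : ∀ p q : E2, p ∈ closure Ω \ K → 0 < ‖p - k‖ → 0 < ‖q - k‖ → v p = v q →
        radial k p = radial k q → ‖p - k‖ ≤ ‖q - k‖ := by
      intro p q hp hnp hnq hv hpq
      by_contra! hlt
      refine H.ne_of_lineMap hk hp (s := ‖q - k‖ / ‖p - k‖) (by positivity)
        ((div_lt_one hnp).2 hlt) ?_
      have : k + (‖q - k‖ / ‖p - k‖) • (p - k) = q := by
        rw [div_eq_mul_inv, mul_smul]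
        unfold radial at hpq
        rw [hpq, smul_smul, mul_inv_cancel₀ hnq.ne']
        module
      rw [this, hv]
    have e : ‖x - k‖ = ‖y - k‖ :=
      le_antisymm (key x y ⟨hxΩ, hxK⟩ hnx hny hxy hr) (key y x ⟨hyΩ, hyK⟩ hny hnx hxy.symm hr.symm)
    unfold radial at hr
    rw [e] at hr
    exact sub_left_injective (smul_right_injective _ (inv_ne_zero hny.ne') hr)
  · intro x r hr hb
    obtain ⟨y, hy, h2, h3, h4⟩ := H.exists_descent hr hb
    have hb' : ∀ ζ ∈ closedBall x r, ζ ∈ closure Ω := fun ζ hζ => subset_closure (hb hζ).1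
    refine ⟨y, hy, fun ζ hζ => ?_, ?_, h4⟩
    · rw [hin y (hb' y hy), hin ζ (hb' ζ hζ)]
      exact h2 ζ hζ
    · rw [hin y (hb' y hy), hin x (hb' x (mem_closedBall_self hr.le))]
      exact h3

end IsPotential

namespace IsLevelFun

variable {Ω K : Set E2} {k : E2} {v : E2 → ℝ} {Du : E2 → E2}

/-- A streamline in a compact set avoiding `K` extends continuously to its endpoint; along it the
level increases, and the distance to each point of higher level decreases. -/
lemma exists_streamline_extension (H : IsLevelFun Ω K k v Du) {G J : Set E2} {α : ℝ → E2} {T : ℝ}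
    (hJ : IsCompact J) (hJΩ : J ⊆ closure Ω \ K) (hα : IsStreamline G Du α T) (hT : 0 < T)
    (hαJ : α '' Icc 0 T ⊆ J) :
    ∃ g : ℝ → E2, Continuous g ∧ EqOn g α (Ico 0 T) ∧ (∀ t ∈ Icc 0 T, g t ∈ J) ∧
      MonotoneOn (v ∘ g) (Icc 0 T) ∧
      ∀ z, ∀ s ∈ Icc 0 T, ∀ t ∈ Icc 0 T, s ≤ t → v (g t) ≤ v z → ‖g t - z‖ ≤ ‖g s - z‖ := by
  obtain ⟨_, _, hα0, hα1⟩ := hα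
  obtain ⟨M, hM⟩ := hJ.exists_bound_of_continuousOn (H.continuousOn_grad.mono hJΩ)
  have hIco : ∀ t ∈ Ico 0 T, α t ∈ J := fun t ht => hαJ ⟨t, ⟨ht.1, ht.2.le⟩, rfl⟩
  have hM0 : 0 ≤ M := (norm_nonneg _).trans (hM _ (hIco 0 ⟨le_rfl, hT⟩))
  have hder : ∀ t ∈ Ico 0 T, HasDerivWithinAt α (Du (α t)) (Ico 0 T) t := by
    intro t ht
    rcases ht.1.eq_or_lt with h | h
    · subst h
      exact hα0.mono fun x hx => hx.1
    · exact (hα1 t ⟨h, ht.2⟩).hasDerivWithinAt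
  have hlip : LipschitzOnWith M.toNNReal α (Ico 0 T) :=
    (convex_Ico 0 T).lipschitzOnWith_of_nnnorm_hasDerivWithin_le hder fun t ht => by
      rw [← NNReal.coe_le_coe, coe_nnnorm, Real.coe_toNNReal _ hM0]
      exact hM _ (hIco t ht)
  obtain ⟨g, hg, hgα⟩ := hlip.extend_finite_dimension
  have hgc := hg.continuous
  have hgJ : ∀ t ∈ Icc 0 T, g t ∈ J := by
    have : closure (Ico 0 T) ⊆ g ⁻¹' J :=
      closure_minimal (fun t ht => by
        show g t ∈ J
        rw [← hgα ht]; exact hIco t ht) (hJ.isClosed.preimage hgc)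
    rwa [closure_Ico hT.ne] at this
  have hgd : ∀ t ∈ Ioo 0 T, HasDerivAt g (Du (g t)) t := by
    intro t ht
    have h1 := hα1 t ht
    rw [hgα ⟨ht.1.le, ht.2⟩] at h1
    refine h1.congr_of_eventuallyEq ?_
    filter_upwards [Ioo_mem_nhds ht.1 ht.2] with s hs using (hgα ⟨hs.1.le, hs.2⟩).symm
  have hvd : ∀ t ∈ Ioo 0 T, HasDerivAt (v ∘ g) (⟪Du (g t), Du (g t)⟫) t := by
    intro t ht
    have hI : Ioo 0 T ∈ nhds t := Ioo_mem_nhds ht.1 ht.2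
    have h1 := (H.hasFDerivWithinAt (g t) (hJΩ (hgJ t (Ioo_subset_Icc_self ht)))).comp_hasDerivWithinAt
      t (hgd t ht).hasDerivWithinAt (s := Ioo 0 T)
      (fun s hs => (hJΩ (hgJ s (Ioo_subset_Icc_self hs))).1)
    exact h1.hasDerivAt hI
  have hmono : MonotoneOn (v ∘ g) (Icc 0 T) := by
    refine monotoneOn_of_deriv_nonneg (convex_Icc 0 T) (H.continuous.comp hgc).continuousOn ?_ ?_
    · rw [interior_Icc]
      exact fun t ht => (hvd t ht).differentiableAt.differentiableWithinAt
    · rw [interior_Icc]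
      intro t ht
      rw [(hvd t ht).deriv]
      exact real_inner_self_nonneg
  refine ⟨g, hgc, hgα.symm, hgJ, hmono, ?_⟩
  intro z s hs t ht hst hz
  have hψ : AntitoneOn (fun r => ‖g r - z‖ ^ 2) (Icc s t) := by
    have hIoo : ∀ r ∈ Ioo s t, r ∈ Ioo 0 T := fun r hr => ⟨hs.1.trans_lt hr.1, hr.2.trans_le ht.2⟩
    have hd : ∀ r ∈ Ioo s t, HasDerivAt (fun r => ‖g r - z‖ ^ 2) (2 * ⟪g r - z, Du (g r)⟫) r :=
      fun r hr => ((hgd r (hIoo r hr)).sub_const z).norm_sq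
    refine antitoneOn_of_deriv_nonpos (convex_Icc s t) (by fun_prop) ?_ ?_
    · rw [interior_Icc]
      exact fun r hr => (hd r hr).differentiableAt.differentiableWithinAt
    · rw [interior_Icc]
      intro r hr
      rw [(hd r hr).deriv]
      have hr' := Ioo_subset_Icc_self (hIoo r hr)
      have h1 := H.inner_nonneg (g r) (hJΩ (hgJ r hr')) z
        ((hmono hr' ht hr.2.le).trans hz)
      rw [real_inner_comm, ← neg_sub z, inner_neg_right]
      linarith
  have := hψ (left_mem_Icc.2 hst) (right_mem_Icc.2 hst) hst
  exact le_of_sq_le_sq this (norm_nonneg _)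

end IsLevelFun

/-- Parametrization by level of a curve along which `v` increases. -/
lemma exists_level_parametrization {v : E2 → ℝ} {g : ℝ → E2} {T c₁ c₂ : ℝ} (hv : Continuous v)
    (hg : Continuous g) (hT : 0 ≤ T) (hmono : MonotoneOn (v ∘ g) (Icc 0 T))
    (hdist : ∀ z, ∀ s ∈ Icc 0 T, ∀ t ∈ Icc 0 T, s ≤ t → v (g t) ≤ v z → ‖g t - z‖ ≤ ‖g s - z‖)
    (h0 : v (g 0) = c₁) (h1 : v (g T) = c₂) :
    ∃ p : ℝ → E2, Continuous p ∧ (∀ c ∈ Icc c₁ c₂, v (p c) = c) ∧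
      (∀ c, p c ∈ g '' Icc 0 T) ∧ (∀ t ∈ Icc 0 T, p (v (g t)) = g t) ∧
      ∀ z, ∀ c ∈ Icc c₁ c₂, ∀ d ∈ Icc c₁ c₂, c ≤ d → d ≤ v z → ‖p d - z‖ ≤ ‖p c - z‖ := by
  have heq : ∀ s ∈ Icc 0 T, ∀ t ∈ Icc 0 T, v (g s) = v (g t) → g s = g t := by
    have : ∀ s ∈ Icc 0 T, ∀ t ∈ Icc 0 T, s ≤ t → v (g s) = v (g t) → g s = g t := by
      intro s hs t ht hst hv
      have := hdist (g s) s hs t ht hst hv.ge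
      rw [sub_self, norm_zero] at this
      exact (sub_eq_zero.1 (norm_le_zero_iff.1 this)).symm
    intro s hs t ht hv
    rcases le_total s t with h | h
    · exact this s hs t ht h hv
    · exact (this t ht s hs h hv.symm).symm
  have hc₁₂ : c₁ ≤ c₂ := by
    rw [← h0, ← h1]
    exact hmono (left_mem_Icc.2 hT) (right_mem_Icc.2 hT) hT
  have hsurj : ∀ c, ∃ t ∈ Icc 0 T, c ∈ Icc c₁ c₂ → v (g t) = c := by
    intro c
    by_cases hc : c ∈ Icc c₁ c₂
    · have := intermediate_value_Icc hT (hv.comp hg).continuousOn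
      simp only [Function.comp, h0, h1] at this
      obtain ⟨t, ht, h⟩ := this hc
      exact ⟨t, ht, fun _ => h⟩
    · exact ⟨0, left_mem_Icc.2 hT, fun h => absurd h hc⟩
  choose τ hτ hτv using hsurj
  have hcont : ContinuousOn (fun c => g (τ c)) (Icc c₁ c₂) := by
    rw [continuousOn_iff_isClosed]
    intro C hC
    refine ⟨(v ∘ g) '' (Icc 0 T ∩ g ⁻¹' C), ?_, ?_⟩
    · exact ((isCompact_Icc.inter_right (hC.preimage hg)).image (hv.comp hg)).isClosed
    · ext c
      constructor
      · rintro ⟨h, hc⟩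
        exact ⟨⟨τ c, ⟨hτ c, h⟩, hτv c hc⟩, hc⟩
      · rintro ⟨⟨t, ⟨ht, h⟩, rfl⟩, hc⟩
        refine ⟨?_, hc⟩
        show g (τ (v (g t))) ∈ C
        rw [heq _ (hτ _) t ht (hτv _ hc)]
        exact h
  have hcl : ∀ c, max c₁ (min c c₂) ∈ Icc c₁ c₂ := fun c =>
    ⟨le_max_left _ _, max_le hc₁₂ (min_le_right _ _)⟩
  have hcl' : ∀ c ∈ Icc c₁ c₂, max c₁ (min c c₂) = c := fun c hc => by
    rw [min_eq_left hc.2, max_eq_right hc.1]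
  refine ⟨fun c => g (τ (max c₁ (min c c₂))), hcont.comp_continuous (by fun_prop) hcl,
    fun c hc => ?_, fun c => ⟨_, hτ _, rfl⟩, fun t ht => ?_, ?_⟩
  · simp only [hcl' c hc]; exact hτv c hc
  · have hc : v (g t) ∈ Icc c₁ c₂ := by
      rw [← h0, ← h1]
      exact ⟨hmono (left_mem_Icc.2 hT) ht ht.1, hmono ht (right_mem_Icc.2 hT) ht.2⟩
    simp only [hcl' _ hc]
    exact heq _ (hτ _) t ht (hτv _ hc)
  · intro z c hc d hd hcd hz
    simp only [hcl' c hc, hcl' d hd]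
    rcases le_total (τ c) (τ d) with h | h
    · exact hdist z _ (hτ c) _ (hτ d) h (by rw [hτv d hd]; exact hz)
    · have := hmono (hτ d) (hτ c) h
      simp only [Function.comp, hτv c hc, hτv d hd] at this
      rw [le_antisymm hcd this]

namespace IsJordanCurve

variable {J : Set E2}

lemma isCompact (hJ : IsJordanCurve J) : IsCompact J := by
  obtain ⟨γ, hc, -, -, rfl⟩ := hJ
  exact isCompact_Icc.image_of_continuousOn hc

lemma isPreconnected_diff_singleton (hJ : IsJordanCurve J) (p : E2) :
    IsPreconnected (J \ {p}) := by
  obtain ⟨γ, hc, h01, hinj, rfl⟩ := hJ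
  by_cases hp : p ∈ γ '' Icc 0 1
  swap
  · rw [sdiff_singleton_eq_self hp]
    exact isPreconnected_Icc.image γ hc
  obtain ⟨t, ht, htp⟩ : ∃ t ∈ Ico (0 : ℝ) 1, γ t = p := by
    obtain ⟨t, ht, rfl⟩ := hp
    rcases ht.2.lt_or_eq with h | h
    · exact ⟨t, ⟨ht.1, h⟩, rfl⟩
    · exact ⟨0, ⟨le_rfl, one_pos⟩, by rw [h, h01]⟩
  subst htp
  rcases ht.1.eq_or_lt with h | h
  · subst h
    have : γ '' Icc 0 1 \ {γ 0} = γ '' Ioo 0 1 := by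
      ext x
      constructor
      · rintro ⟨⟨s, hs, rfl⟩, hx⟩
        refine ⟨s, ⟨hs.1.lt_of_ne ?_, hs.2.lt_of_ne ?_⟩, rfl⟩
        · rintro rfl; exact hx rfl
        · rintro rfl; exact hx h01.symm
      · rintro ⟨s, hs, rfl⟩
        refine ⟨⟨s, Ioo_subset_Icc_self hs, rfl⟩, fun hx => ?_⟩
        exact hs.1.ne' (hinj ⟨hs.1.le, hs.2⟩ ht hx)
    rw [this]
    exact isPreconnected_Ioo.image γ (hc.mono Ioo_subset_Icc_self)
  · have : γ '' Icc 0 1 \ {γ t} = γ '' Ico 0 t ∪ γ '' Ioc t 1 := by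
      ext x
      constructor
      · rintro ⟨⟨s, hs, rfl⟩, hx⟩
        rcases lt_trichotomy s t with h | rfl | h
        · exact Or.inl ⟨s, ⟨hs.1, h⟩, rfl⟩
        · exact absurd rfl hx
        · exact Or.inr ⟨s, ⟨h, hs.2⟩, rfl⟩
      · rintro (⟨s, hs, rfl⟩ | ⟨s, hs, rfl⟩)
        · exact ⟨⟨s, ⟨hs.1, (hs.2.trans ht.2).le⟩, rfl⟩,
            fun hx => hs.2.ne (hinj ⟨hs.1, hs.2.trans ht.2⟩ ht hx)⟩
        · refine ⟨⟨s, ⟨(h.trans hs.1).le, hs.2⟩, rfl⟩, fun hx => ?_⟩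
          rcases hs.2.lt_or_eq with h1 | rfl
          · exact hs.1.ne' (hinj ⟨(h.trans hs.1).le, h1⟩ ht hx)
          · exact h.ne (hinj ⟨le_rfl, one_pos⟩ ht (h01.trans hx))
    rw [this]
    refine IsPreconnected.union (γ 0) ⟨0, ⟨le_rfl, h⟩, rfl⟩ ⟨1, ⟨ht.2, le_rfl⟩, h01.symm⟩ ?_ ?_
    · exact isPreconnected_Ico.image γ (hc.mono fun s hs => ⟨hs.1, (hs.2.trans ht.2).le⟩)
    · exact isPreconnected_Ioc.image γ (hc.mono fun s hs => ⟨(h.trans hs.1).le, hs.2⟩)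

/-- Two closed sets covering a Jordan curve meet in more than one point, unless one is trivial. -/
lemma subset_singleton_or (hJ : IsJordanCurve J) {X Y : Set E2} (hX : IsClosed X)
    (hY : IsClosed Y) (hXY : X ∪ Y = J) {p : E2} (hp : X ∩ Y ⊆ {p}) : X ⊆ {p} ∨ Y ⊆ {p} := by
  by_contra! h
  obtain ⟨x, hx, hxp⟩ := not_subset.1 h.1
  obtain ⟨y, hy, hyp⟩ := not_subset.1 h.2
  obtain ⟨z, hz, hz'⟩ := isPreconnected_closed_iff.1 (hJ.isPreconnected_diff_singleton p) X Y hX hY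
    (fun z hz => hXY ▸ hz.1) ⟨x, ⟨hXY ▸ Or.inl hx, hxp⟩, hx⟩ ⟨y, ⟨hXY ▸ Or.inr hy, hyp⟩, hy⟩
  exact hz.2 (hp hz')

end IsJordanCurve

/-- In a Jordan curve formed by an arc `w` and two disjoint closed pieces of its complement which
touch `w` in one point each, these points are the endpoints of `w`. -/
lemma arc_endpoints_eq {J S A B : Set E2} (hJ : IsJordanCurve J) {w : ℝ → E2}
    (hw : ContinuousOn w (Icc 0 1)) (hwi : InjOn w (Icc 0 1)) (hS : IsClosed S) (hA : IsClosed A)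
    (hB : IsClosed B) (hcov : J = S ∪ w '' Icc 0 1 ∪ A ∪ B) (hSw : Disjoint S (w '' Icc 0 1))
    {pA pB : E2} (hA1 : A ∩ w '' Icc 0 1 ⊆ {pA}) (hB1 : B ∩ w '' Icc 0 1 ⊆ {pB})
    (hX : ∃ x ∈ S, ∃ y ∈ S, x ≠ y) :
    ∃ r₁ r₂ : ℝ, (r₁ = 0 ∧ r₂ = 1 ∨ r₁ = 1 ∧ r₂ = 0) ∧ w r₁ = pA ∧ w r₂ = pB ∧ pA ∈ A ∧ pB ∈ B := by
  set W := w '' Icc 0 1 with hW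
  have h0 : (0 : ℝ) ∈ Icc (0 : ℝ) 1 := ⟨le_rfl, zero_le_one⟩
  have h1 : (1 : ℝ) ∈ Icc (0 : ℝ) 1 := ⟨zero_le_one, le_rfl⟩
  have hWc : IsClosed W := (isCompact_Icc.image_of_continuousOn hw).isClosed
  have hnot : ∀ p, ¬ (S ∪ A ∪ B) ∩ W ⊆ {p} := by
    intro p hp
    rcases hJ.subset_singleton_or ((hS.union hA).union hB) hWc (by rw [hcov]; ac_rfl) hp with h | h
    · obtain ⟨x, hx, y, hy, hxy⟩ := hX
      exact hxy ((h (Or.inl (Or.inl hx))).trans (h (Or.inl (Or.inl hy))).symm)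
    · have e : w 0 = w 1 := (h ⟨0, h0, rfl⟩).trans (h ⟨1, h1, rfl⟩).symm
      exact zero_ne_one (hwi h0 h1 e)
  have hsub : (S ∪ A ∪ B) ∩ W ⊆ (A ∩ W) ∪ (B ∩ W) := by
    rintro x ⟨(hx | hx) | hx, hxW⟩
    · exact absurd hxW (hSw.notMem_of_mem_left hx)
    · exact Or.inl ⟨hx, hxW⟩
    · exact Or.inr ⟨hx, hxW⟩
  have hpA : pA ∈ A ∩ W := by
    by_contra hn
    refine hnot pB (hsub.trans ?_)
    rintro x (hx | hx)
    · exact absurd (hA1 hx ▸ hx) hn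
    · exact hB1 hx
  have hpB : pB ∈ B ∩ W := by
    by_contra hn
    refine hnot pA (hsub.trans ?_)
    rintro x (hx | hx)
    · exact hA1 hx
    · exact absurd (hB1 hx ▸ hx) hn
  have hne : pA ≠ pB := by
    rintro rfl
    exact hnot pA (hsub.trans (union_subset hA1 hB1))
  obtain ⟨hpA', r₁, hr₁, e₁⟩ := hpA
  obtain ⟨hpB', r₂, hr₂, e₂⟩ := hpB
  have hrne : r₁ ≠ r₂ := fun h => hne (by rw [← e₁, ← e₂, h])
  have hIm : ∀ a b : ℝ, 0 ≤ a → b ≤ 1 → IsClosed (w '' Icc a b) := fun a b ha hb =>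
    (isCompact_Icc.image_of_continuousOn (hw.mono (Icc_subset_Icc ha hb))).isClosed
  have hsplit : ∀ r ∈ Icc (0 : ℝ) 1, W = w '' Icc 0 r ∪ w '' Icc r 1 := fun r hr => by
    rw [← image_union, Icc_union_Icc_eq_Icc hr.1 hr.2]
  have hmeet : ∀ r ∈ Icc (0 : ℝ) 1, w '' Icc 0 r ∩ w '' Icc r 1 ⊆ {w r} := by
    rintro r hr x ⟨⟨s, hs, rfl⟩, t, ht, e⟩
    have := hwi ⟨hr.1.trans ht.1, ht.2⟩ ⟨hs.1, hs.2.trans hr.2⟩ e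
    subst this
    rw [le_antisymm hs.2 ht.1]; rfl
  have key : ∀ r s : ℝ, r ∈ Icc (0 : ℝ) 1 → s ∈ Icc (0 : ℝ) 1 → r < s →
      (∀ x ∈ A ∪ B, x ∈ W → x = w r ∨ x = w s) → r = 0 ∧ s = 1 := by
    intro r s hr hs hrs hAB
    have hcomb : ∀ a b : ℝ, a ∈ Icc (0 : ℝ) 1 → b ∈ Icc (0 : ℝ) 1 → a ≠ b →
        w a = w b → False := fun a b ha hb hab e => hab (hwi ha hb e)
    constructor
    · have hm : w '' Icc 0 r ∩ (w '' Icc r 1 ∪ (S ∪ A ∪ B)) ⊆ {w r} := by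
        rintro x ⟨⟨t, ht, rfl⟩, hx | hx⟩
        · exact hmeet r hr ⟨⟨t, ht, rfl⟩, hx⟩
        · have hxW : w t ∈ W := ⟨t, ⟨ht.1, ht.2.trans hr.2⟩, rfl⟩
          have : w t ∈ A ∪ B := by
            rcases hsub ⟨hx, hxW⟩ with h | h
            · exact Or.inl h.1
            · exact Or.inr h.1
          rcases hAB _ this hxW with h | h
          · exact h
          · exact (hcomb t s ⟨ht.1, ht.2.trans hr.2⟩ hs (ht.2.trans_lt hrs).ne h).elim
      rcases hJ.subset_singleton_or (hIm 0 r le_rfl hr.2)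
        ((hIm r 1 hr.1 le_rfl).union ((hS.union hA).union hB))
        (by rw [hcov, hsplit r hr]; ac_rfl) hm with h | h
      · exact (hwi h0 hr (h ⟨0, ⟨le_rfl, hr.1⟩, rfl⟩)).symm
      · exact (hcomb s r hs hr hrs.ne' (h (Or.inl ⟨s, ⟨hrs.le, hs.2⟩, rfl⟩))).elim
    · have hm : w '' Icc s 1 ∩ (w '' Icc 0 s ∪ (S ∪ A ∪ B)) ⊆ {w s} := by
        rintro x ⟨⟨t, ht, rfl⟩, hx | hx⟩
        · exact hmeet s hs ⟨hx, ⟨t, ht, rfl⟩⟩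
        · have hxW : w t ∈ W := ⟨t, ⟨hs.1.trans ht.1, ht.2⟩, rfl⟩
          have : w t ∈ A ∪ B := by
            rcases hsub ⟨hx, hxW⟩ with h | h
            · exact Or.inl h.1
            · exact Or.inr h.1
          rcases hAB _ this hxW with h | h
          · exact (hcomb t r ⟨hs.1.trans ht.1, ht.2⟩ hr (hrs.trans_le ht.1).ne' h).elim
          · exact h
      rcases hJ.subset_singleton_or (hIm s 1 hs.1 le_rfl)
        ((hIm 0 s le_rfl hs.2).union ((hS.union hA).union hB))
        (by rw [hcov, hsplit s hs]; ac_rfl) hm with h | h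
      · exact (hwi h1 hs (h ⟨1, ⟨hs.2, le_rfl⟩, rfl⟩)).symm
      · exact (hcomb r s hr hs hrs.ne (h (Or.inl ⟨r, ⟨hr.1, hrs.le⟩, rfl⟩))).elim
  have hABW : ∀ x ∈ A ∪ B, x ∈ W → x = w r₁ ∨ x = w r₂ := by
    rintro x (hx | hx) hxW
    · exact Or.inl ((hA1 ⟨hx, hxW⟩).trans e₁.symm)
    · exact Or.inr ((hB1 ⟨hx, hxW⟩).trans e₂.symm)
  refine ⟨r₁, r₂, ?_, e₁, e₂, hpA', hpB'⟩
  rcases lt_or_gt_of_ne hrne with h | h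
  · exact Or.inl (key r₁ r₂ hr₁ hr₂ h hABW)
  · have := key r₂ r₁ hr₂ hr₁ h fun x hx hxW => (hABW x hx hxW).symm
    exact Or.inr ⟨this.2, this.1⟩

/-- The planar cross product. -/
def cross (p q : E2) : ℝ := p 0 * q 1 - p 1 * q 0

lemma continuous_cross : Continuous fun z : E2 × E2 => cross z.1 z.2 := by
  unfold cross; fun_prop

lemma sq_add_sq_of_norm_eq_one {x : E2} (hx : ‖x‖ = 1) : x 0 ^ 2 + x 1 ^ 2 = 1 := by
  have := EuclideanSpace.norm_sq_eq x
  rw [hx, Fin.sum_univ_two] at this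
  simpa using this.symm

/-- The half-angle coordinates of a unit vector. -/
lemma exists_half_angle {x : E2} (hx : ‖x‖ = 1) :
    ∃ p q : ℝ, x 0 = p ^ 2 - q ^ 2 ∧ x 1 = 2 * p * q ∧ p ^ 2 + q ^ 2 = 1 := by
  obtain ⟨z, hz⟩ := IsAlgClosed.exists_pow_nat_eq (⟨x 0, x 1⟩ : ℂ) (n := 2) two_pos
  have h0 := congrArg Complex.re hz
  have h1 := congrArg Complex.im hz
  simp only [sq, Complex.mul_re, Complex.mul_im] at h0 h1
  refine ⟨z.re, z.im, by rw [← h0]; ring, by rw [← h1]; ring, ?_⟩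
  have h2 := sq_add_sq_of_norm_eq_one hx
  have h3 : (z.re ^ 2 + z.im ^ 2) ^ 2 = 1 := by
    rw [← h2, ← h0, ← h1]; ring
  nlinarith [sq_nonneg z.re, sq_nonneg z.im]

lemma cross_sub_sub_eq {a b x : E2} {pa qa pb qb px qx : ℝ}
    (a0 : a 0 = pa ^ 2 - qa ^ 2) (a1 : a 1 = 2 * pa * qa) (na : pa ^ 2 + qa ^ 2 = 1)
    (b0 : b 0 = pb ^ 2 - qb ^ 2) (b1 : b 1 = 2 * pb * qb) (nb : pb ^ 2 + qb ^ 2 = 1)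
    (x0 : x 0 = px ^ 2 - qx ^ 2) (x1 : x 1 = 2 * px * qx) (nx : px ^ 2 + qx ^ 2 = 1) :
    cross (b - a) (x - a) =
      -4 * (pa * qb - qa * pb) * (pb * qx - qb * px) * (px * qa - qx * pa) := by
  unfold cross
  simp only [PiLp.sub_apply, a0, a1, b0, b1, x0, x1]
  linear_combination
    -((pa ^ 2 - qa ^ 2) * (2 * pb * qb) - (2 * pa * qa) * (pb ^ 2 - qb ^ 2)) * nx
    - ((pb ^ 2 - qb ^ 2) * (2 * px * qx) - (2 * pb * qb) * (px ^ 2 - qx ^ 2)) * na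
    - ((px ^ 2 - qx ^ 2) * (2 * pa * qa) - (2 * px * qx) * (pa ^ 2 - qa ^ 2)) * nb

lemma eq_of_half_angle {a b : E2} {pa qa pb qb : ℝ}
    (a0 : a 0 = pa ^ 2 - qa ^ 2) (a1 : a 1 = 2 * pa * qa) (na : pa ^ 2 + qa ^ 2 = 1)
    (b0 : b 0 = pb ^ 2 - qb ^ 2) (b1 : b 1 = 2 * pb * qb) (nb : pb ^ 2 + qb ^ 2 = 1)
    (h : pa * qb - qa * pb = 0) : a = b := by
  have h1 : pa ^ 2 = pb ^ 2 := by
    linear_combination (pa * qb + qa * pb) * h - pa ^ 2 * nb + pb ^ 2 * na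
  have h2 : pa * qa = pb * qb := by
    linear_combination (qa * qb - pa * pb) * h - pa * qa * nb + pb * qb * na
  ext i
  fin_cases i
  · show a 0 = b 0
    rw [a0, b0]
    linear_combination 2 * h1 - na + nb
  · show a 1 = b 1
    rw [a1, b1]
    linear_combination 2 * h2

lemma eq_or_eq_of_cross_eq_zero {a b x : E2} (ha : ‖a‖ = 1) (hb : ‖b‖ = 1) (hx : ‖x‖ = 1)
    (hab : a ≠ b) (h : cross (b - a) (x - a) = 0) : x = a ∨ x = b := by
  obtain ⟨pa, qa, a0, a1, na⟩ := exists_half_angle ha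
  obtain ⟨pb, qb, b0, b1, nb⟩ := exists_half_angle hb
  obtain ⟨px, qx, x0, x1, nx⟩ := exists_half_angle hx
  rw [cross_sub_sub_eq a0 a1 na b0 b1 nb x0 x1 nx] at h
  rcases mul_eq_zero.1 h with h | h
  · rcases mul_eq_zero.1 h with h | h
    · rcases mul_eq_zero.1 h with h | h
      · norm_num at h
      · exact absurd (eq_of_half_angle a0 a1 na b0 b1 nb h) hab
    · exact Or.inr (eq_of_half_angle b0 b1 nb x0 x1 nx h).symm
  · exact Or.inl (eq_of_half_angle x0 x1 nx a0 a1 na h)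

/-- If the chord `ab` separates `y` from `o`, then the chord `yo` separates `a` from `b`. -/
lemma cross_mul_cross_nonpos {a b y o : E2} (ha : ‖a‖ = 1) (hb : ‖b‖ = 1) (hy : ‖y‖ = 1)
    (ho : ‖o‖ = 1) (h1 : 0 ≤ cross (b - a) (y - a)) (h2 : cross (b - a) (o - a) < 0) :
    cross (o - y) (a - y) * cross (o - y) (b - y) ≤ 0 := by
  obtain ⟨pa, qa, a0, a1, na⟩ := exists_half_angle ha
  obtain ⟨pb, qb, b0, b1, nb⟩ := exists_half_angle hb
  obtain ⟨px, qx, x0, x1, nx⟩ := exists_half_angle hy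
  obtain ⟨po, qo, o0, o1, no⟩ := exists_half_angle ho
  have h3 := mul_nonpos_of_nonneg_of_nonpos h1 h2.le
  have hne := h2.ne
  rw [cross_sub_sub_eq a0 a1 na b0 b1 nb x0 x1 nx, cross_sub_sub_eq a0 a1 na b0 b1 nb o0 o1 no]
    at h3
  rw [cross_sub_sub_eq a0 a1 na b0 b1 nb o0 o1 no] at hne
  rw [cross_sub_sub_eq x0 x1 nx o0 o1 no a0 a1 na, cross_sub_sub_eq x0 x1 nx o0 o1 no b0 b1 nb]
  have hs : 0 < (pa * qb - qa * pb) ^ 2 := by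
    refine sq_pos_of_ne_zero fun h => hne ?_
    rw [h]; ring
  have e : (pa * qb - qa * pb) ^ 2 * ((-4 * (px * qo - qx * po) * (po * qa - qo * pa) * (pa * qx - qa * px)) *
      (-4 * (px * qo - qx * po) * (po * qb - qo * pb) * (pb * qx - qb * px))) =
      (px * qo - qx * po) ^ 2 * ((-4 * (pa * qb - qa * pb) * (pb * qx - qb * px) * (px * qa - qx * pa)) *
      (-4 * (pa * qb - qa * pb) * (pb * qo - qb * po) * (po * qa - qo * pa))) := by ring
  by_contra! hpos
  have := mul_pos hs hpos
  rw [e] at this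
  have h4 := mul_nonpos_of_nonneg_of_nonpos (sq_nonneg (px * qo - qx * po)) h3
  linarith

/-- Some unit vector lies strictly on the negative side of a chord. -/
lemma exists_cross_neg {a b : E2} (ha : ‖a‖ = 1) (hb : ‖b‖ = 1) (hab : a ≠ b) :
    ∃ o : E2, ‖o‖ = 1 ∧ cross (b - a) (o - a) < 0 := by
  have hd : 0 < ‖b - a‖ := norm_pos_iff.2 (sub_ne_zero.2 hab.symm)
  have hd2 : ‖b - a‖ ^ 2 = (b 0 - a 0) ^ 2 + (b 1 - a 1) ^ 2 := by
    rw [EuclideanSpace.norm_sq_eq, Fin.sum_univ_two]; simp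
  set n := ‖b - a‖ with hn
  have ha2 := sq_add_sq_of_norm_eq_one ha
  have hb2 := sq_add_sq_of_norm_eq_one hb
  refine ⟨!₂[(b 1 - a 1) / n, -(b 0 - a 0) / n], ?_, ?_⟩
  · rw [EuclideanSpace.norm_eq, Fin.sum_univ_two, Real.sqrt_eq_one]
    simp only [Real.norm_eq_abs, sq_abs]
    simp
    field_simp
    linarith
  · unfold cross
    simp
    have e : (b 0 - a 0) * ((a 0 - b 0) / n - a 1) - (b 1 - a 1) * ((b 1 - a 1) / n - a 0) =
        -n - ((b 0 - a 0) * a 1 - (b 1 - a 1) * a 0) := by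
      field_simp
      linear_combination hd2
    rw [← sub_neg, e]
    set c := (b 0 - a 0) * a 1 - (b 1 - a 1) * a 0 with hc
    have hi : (b 0 - a 0) * a 0 + (b 1 - a 1) * a 1 = - n ^ 2 / 2 := by
      rw [hd2]; linear_combination (1/2) * hb2 - (1/2) * ha2
    have h1 : c ^ 2 + (n ^ 2 / 2) ^ 2 = n ^ 2 := by
      have : (n ^ 2 / 2) ^ 2 = ((b 0 - a 0) * a 0 + (b 1 - a 1) * a 1) ^ 2 := by rw [hi]; ring
      rw [this, hc, hd2]
      linear_combination ((b 0 - a 0) ^ 2 + (b 1 - a 1) ^ 2) * ha2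
    have h2 : c ^ 2 < n ^ 2 := by
      have : 0 < (n ^ 2 / 2) ^ 2 := by positivity
      linarith
    have := abs_lt_of_sq_lt_sq h2 hd.le
    have := (abs_lt.1 this).1
    linarith

/-- Two disjoint curves parametrized by level, between the levels `c₁` and `c₂`. -/
structure IsLevelPair (k : E2) (v : E2 → ℝ) (p q : ℝ → E2) (c₁ c₂ : ℝ) : Prop where
  nonneg : 0 ≤ c₁
  lt : c₁ < c₂
  lt_one : c₂ < 1
  continuous_left : Continuous p
  continuous_right : Continuous q
  level_left : ∀ c ∈ Icc c₁ c₂, v (p c) = c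
  level_right : ∀ c ∈ Icc c₁ c₂, v (q c) = c
  ne : ∀ c ∈ Icc c₁ c₂, p c ≠ q c
  left_ne : ∀ c, p c ≠ k
  right_ne : ∀ c, q c ≠ k

/-- The side on which the direction of `x` lies with respect to the chord through the directions
of the points of the two curves on the level of `x`. -/
def side (k : E2) (v : E2 → ℝ) (p q : ℝ → E2) (x : E2) : ℝ :=
  cross (radial k (q (v x)) - radial k (p (v x))) (radial k x - radial k (p (v x)))

lemma side_swap (k : E2) (v : E2 → ℝ) (p q : ℝ → E2) (x : E2) :
    side k v q p x = -side k v p q x := by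
  unfold side cross
  simp only [PiLp.sub_apply]
  ring

lemma norm_radial {k x : E2} (h : x ≠ k) : ‖radial k x‖ = 1 := by
  have : ‖x - k‖ ≠ 0 := norm_ne_zero_iff.2 (sub_ne_zero.2 h)
  unfold radial
  rw [norm_smul, norm_inv, norm_norm, inv_mul_cancel₀ this]

lemma continuousOn_radial (k : E2) : ContinuousOn (radial k) {k}ᶜ := by
  unfold radial
  have h : ContinuousOn (fun x : E2 => ‖x - k‖⁻¹) {k}ᶜ :=
    ContinuousOn.inv₀ (by fun_prop) fun x hx => norm_ne_zero_iff.2 (sub_ne_zero.2 hx)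
  exact h.smul (by fun_prop)

namespace IsLevelPair

variable {k : E2} {v : E2 → ℝ} {p q : ℝ → E2} {c₁ c₂ : ℝ}

lemma symm (P : IsLevelPair k v p q c₁ c₂) : IsLevelPair k v q p c₁ c₂ :=
  ⟨P.nonneg, P.lt, P.lt_one, P.continuous_right, P.continuous_left, P.level_right, P.level_left,
    fun c hc => (P.ne c hc).symm, P.right_ne, P.left_ne⟩

lemma continuousOn_side (P : IsLevelPair k v p q c₁ c₂) (hv : Continuous v) :
    ContinuousOn (side k v p q) {k}ᶜ := by
  have h1 : Continuous fun x => radial k (p (v x)) :=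
    (continuousOn_radial k).comp_continuous (P.continuous_left.comp hv) fun x => P.left_ne _
  have h2 : Continuous fun x => radial k (q (v x)) :=
    (continuousOn_radial k).comp_continuous (P.continuous_right.comp hv) fun x => P.right_ne _
  exact continuous_cross.comp_continuousOn
    ((h2.sub h1).continuousOn.prodMk ((continuousOn_radial k).sub h1.continuousOn))

end IsLevelPair

namespace IsLevelFun

variable {Ω K : Set E2} {k : E2} {v : E2 → ℝ} {Du : E2 → E2} {p q : ℝ → E2} {c₁ c₂ : ℝ}

lemma ne_of_lt_one (H : IsLevelFun Ω K k v Du) {x : E2} (h : v x < 1) : x ≠ k := by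
  rintro rfl
  exact h.ne (H.eq_one _ H.mem)

lemma radial_left_ne (H : IsLevelFun Ω K k v Du) (P : IsLevelPair k v p q c₁ c₂) {c : ℝ}
    (hc : c ∈ Icc c₁ c₂) : radial k (p c) ≠ radial k (q c) := fun h =>
  P.ne c hc (H.eq_of_radial_eq _ _ (by rw [P.level_left c hc]; exact P.nonneg.trans hc.1)
    (by rw [P.level_left c hc]; exact hc.2.trans_lt P.lt_one)
    (by rw [P.level_left c hc, P.level_right c hc]) h)

lemma eq_of_side_eq_zero (H : IsLevelFun Ω K k v Du) (P : IsLevelPair k v p q c₁ c₂) {x : E2}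
    (hx : v x ∈ Icc c₁ c₂) (h : side k v p q x = 0) : x = p (v x) ∨ x = q (v x) := by
  have h0 : 0 ≤ v x := P.nonneg.trans hx.1
  have h1 : v x < 1 := hx.2.trans_lt P.lt_one
  rcases eq_or_eq_of_cross_eq_zero (norm_radial (P.left_ne _)) (norm_radial (P.right_ne _))
    (norm_radial (H.ne_of_lt_one h1)) (H.radial_left_ne P hx) h with h | h
  · exact Or.inl (H.eq_of_radial_eq _ _ h0 h1 (P.level_left _ hx).symm h)
  · exact Or.inr (H.eq_of_radial_eq _ _ h0 h1 (P.level_right _ hx).symm h)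

/-- A path in a level set on the nonnegative side, through the points of both curves, covers the
part of the level set on that side. -/
lemma mem_image_of_side_nonneg (H : IsLevelFun Ω K k v Du) (P : IsLevelPair k v p q c₁ c₂)
    {c : ℝ} (hc : c ∈ Icc c₁ c₂) {γ : ℝ → E2} {r₁ r₂ : ℝ} (hγ : ContinuousOn γ (Icc 0 1))
    (hr₁ : r₁ ∈ Icc (0 : ℝ) 1) (hr₂ : r₂ ∈ Icc (0 : ℝ) 1) (e₁ : γ r₁ = p c) (e₂ : γ r₂ = q c)
    (hl : ∀ r ∈ Icc (0 : ℝ) 1, v (γ r) = c) (hs : ∀ r ∈ Icc (0 : ℝ) 1, 0 ≤ side k v p q (γ r))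
    {y : E2} (hy : v y = c) (hys : 0 ≤ side k v p q y) : y ∈ γ '' Icc 0 1 := by
  subst hy
  have h0 : 0 ≤ v y := P.nonneg.trans hc.1
  have h1 : v y < 1 := hc.2.trans_lt P.lt_one
  have ha := norm_radial (P.left_ne (v y))
  have hb := norm_radial (P.right_ne (v y))
  have hyn := norm_radial (H.ne_of_lt_one h1)
  obtain ⟨o, ho, hneg⟩ := exists_cross_neg ha hb (H.radial_left_ne P hc)
  have hsep := cross_mul_cross_nonpos ha hb hyn ho hys hneg
  set f : ℝ → ℝ := fun r => cross (o - radial k y) (radial k (γ r) - radial k y) with hf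
  have hγk : ∀ r ∈ Icc (0 : ℝ) 1, γ r ≠ k := fun r hr =>
    H.ne_of_lt_one (by rw [hl r hr]; exact h1)
  have hfc : ContinuousOn f (Icc 0 1) :=
    continuous_cross.comp_continuousOn (continuousOn_const.prodMk
      (((continuousOn_radial k).comp hγ hγk).sub continuousOn_const))
  have hzero : ∃ r ∈ Icc (0 : ℝ) 1, f r = 0 := by
    have e1 : f r₁ = cross (o - radial k y) (radial k (p (v y)) - radial k y) := by
      rw [← e₁]
    have e2 : f r₂ = cross (o - radial k y) (radial k (q (v y)) - radial k y) := by
      rw [← e₂]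
    rw [← e1, ← e2] at hsep
    rcases mul_nonpos_iff.1 hsep with ⟨h, h'⟩ | ⟨h, h'⟩
    · exact isPreconnected_Icc.intermediate_value hr₂ hr₁ hfc ⟨h', h⟩
    · exact isPreconnected_Icc.intermediate_value hr₁ hr₂ hfc ⟨h, h'⟩
  obtain ⟨r, hr, hfr⟩ := hzero
  have hyo : radial k y ≠ o := by
    rintro rfl
    exact absurd hneg (not_lt.2 hys)
  refine ⟨r, hr, ?_⟩
  rcases eq_or_eq_of_cross_eq_zero hyn ho (norm_radial (hγk r hr)) hyo hfr with h | h
  · exact H.eq_of_radial_eq _ _ (by rw [hl r hr]; exact h0) (by rw [hl r hr]; exact h1) (hl r hr) h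
  · exfalso
    have := hs r hr
    unfold side at this
    rw [hl r hr, h] at this
    linarith

/-- An injective path in a level set between the points of the two curves stays on one side. -/
lemma side_nonneg_or_nonpos (H : IsLevelFun Ω K k v Du) (P : IsLevelPair k v p q c₁ c₂)
    {c : ℝ} (hc : c ∈ Icc c₁ c₂) {γ : ℝ → E2} (hγ : ContinuousOn γ (Icc 0 1))
    (hi : InjOn γ (Icc 0 1)) {r₁ r₂ : ℝ} (hr : r₁ = 0 ∧ r₂ = 1 ∨ r₁ = 1 ∧ r₂ = 0)
    (e₁ : γ r₁ = p c) (e₂ : γ r₂ = q c) (hl : ∀ r ∈ Icc (0 : ℝ) 1, v (γ r) = c) :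
    (∀ r ∈ Icc (0 : ℝ) 1, 0 ≤ side k v p q (γ r)) ∨
      ∀ r ∈ Icc (0 : ℝ) 1, side k v p q (γ r) ≤ 0 := by
  have hv := H.continuous
  have hγk : ∀ r ∈ Icc (0 : ℝ) 1, γ r ≠ k := fun r hr =>
    H.ne_of_lt_one (by rw [hl r hr]; exact hc.2.trans_lt P.lt_one)
  have hfc : ContinuousOn (fun r => side k v p q (γ r)) (Icc 0 1) :=
    (P.continuousOn_side hv).comp hγ hγk
  have hr₁ : r₁ ∈ Icc (0 : ℝ) 1 := by rcases hr with h | h <;> simp [h.1]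
  have hr₂ : r₂ ∈ Icc (0 : ℝ) 1 := by rcases hr with h | h <;> simp [h.2]
  have hz : ∀ r ∈ Icc (0 : ℝ) 1, side k v p q (γ r) = 0 → r = 0 ∨ r = 1 := by
    intro r hr' h
    rcases H.eq_of_side_eq_zero P (by rw [hl r hr']; exact hc) h with h | h <;>
      rw [hl r hr'] at h
    · rw [hi hr' hr₁ (h.trans e₁.symm)]
      rcases hr with h | h <;> simp [h.1]
    · rw [hi hr' hr₂ (h.trans e₂.symm)]
      rcases hr with h | h <;> simp [h.2]
  by_contra! hcon
  obtain ⟨⟨s, hs, hs0⟩, t, ht, ht0⟩ := hcon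
  have hend : ∀ r, r = r₁ ∨ r = r₂ → side k v p q (γ r) = 0 := by
    rintro r (rfl | rfl)
    · unfold side
      rw [hl _ hr₁, e₁]; simp [cross]
    · unfold side
      rw [hl _ hr₂, e₂]; simp only [cross]; ring
  have hend' : ∀ r, r = 0 ∨ r = 1 → side k v p q (γ r) = 0 := by
    rintro r (rfl | rfl) <;> apply hend <;> rcases hr with h | h <;> simp [h.1, h.2]
  have hIoo : ∀ r ∈ Icc (0 : ℝ) 1, side k v p q (γ r) ≠ 0 → r ∈ Ioo (0 : ℝ) 1 := by
    intro r hr h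
    refine ⟨hr.1.lt_of_ne fun h' => h (hend' r (Or.inl h'.symm)),
      hr.2.lt_of_ne fun h' => h (hend' r (Or.inr h'))⟩
  obtain ⟨r, hr', h⟩ := isPreconnected_Ioo.intermediate_value (hIoo s hs hs0.ne)
    (hIoo t ht ht0.ne') (hfc.mono Ioo_subset_Icc_self) ⟨hs0.le, ht0.le⟩
  rcases hz r (Ioo_subset_Icc_self hr') h with h | h
  · exact hr'.1.ne' h
  · exact hr'.2.ne h

/-- If the upper and lower arcs lie on opposite sides, the component of `k` in the complement of
the quadrilateral boundary is bounded. -/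
lemma isBounded_component (H : IsLevelFun Ω K k v Du) (P : IsLevelPair k v p q c₁ c₂)
    {J : Set E2} {s w : ℝ → E2} {r₁ r₂ t₁ t₂ : ℝ} (hs : ContinuousOn s (Icc 0 1))
    (hw : ContinuousOn w (Icc 0 1))
    (hr₁ : r₁ ∈ Icc (0 : ℝ) 1) (hr₂ : r₂ ∈ Icc (0 : ℝ) 1)
    (ht₁ : t₁ ∈ Icc (0 : ℝ) 1) (ht₂ : t₂ ∈ Icc (0 : ℝ) 1)
    (ew₁ : w r₁ = p c₂) (ew₂ : w r₂ = q c₂) (es₁ : s t₁ = p c₁) (es₂ : s t₂ = q c₁)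
    (hlw : ∀ r ∈ Icc (0 : ℝ) 1, v (w r) = c₂) (hls : ∀ r ∈ Icc (0 : ℝ) 1, v (s r) = c₁)
    (hsw : ∀ r ∈ Icc (0 : ℝ) 1, 0 ≤ side k v p q (w r))
    (hss : ∀ r ∈ Icc (0 : ℝ) 1, side k v p q (s r) ≤ 0)
    (hJw : w '' Icc 0 1 ⊆ J) (hJs : s '' Icc 0 1 ⊆ J) (hJp : ∀ c, p c ∈ J) (hJq : ∀ c, q c ∈ J)
    (hJk : k ∉ J) : Bornology.IsBounded (connectedComponentIn Jᶜ k) := by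
  have hv := H.continuous
  have hsc := P.continuousOn_side hv
  set U := {x | c₂ < v x} ∪ ({x | c₁ < v x} ∩ ({k}ᶜ ∩ side k v p q ⁻¹' Iio 0)) with hU
  set V := {x | v x < c₁} ∪ ({x | v x < c₂} ∩ ({k}ᶜ ∩ side k v p q ⁻¹' Ioi 0)) with hV
  have hUo : IsOpen U := (isOpen_lt continuous_const hv).union
    ((isOpen_lt continuous_const hv).inter
      (hsc.isOpen_inter_preimage isOpen_compl_singleton isOpen_Iio))
  have hVo : IsOpen V := (isOpen_lt hv continuous_const).union
    ((isOpen_lt hv continuous_const).inter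
      (hsc.isOpen_inter_preimage isOpen_compl_singleton isOpen_Ioi))
  have hdisj : Disjoint U V := by
    rw [Set.disjoint_left]
    have := P.lt
    rintro x (hx | ⟨hx, hx1, hx2⟩) (hx' | ⟨hx', hx1', hx2'⟩) <;>
      simp only [mem_ofPred_eq, mem_preimage, mem_Iio, mem_Ioi] at * <;> linarith
  have hcov : Jᶜ ⊆ U ∪ V := by
    intro x hx
    have hlt := P.lt
    rcases lt_or_ge c₂ (v x) with h2 | h2
    · exact Or.inl (Or.inl h2)
    rcases lt_or_ge (v x) c₁ with h1 | h1
    · exact Or.inr (Or.inl h1)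
    have hxk : x ≠ k := H.ne_of_lt_one (h2.trans_lt P.lt_one)
    rcases lt_trichotomy (side k v p q x) 0 with h | h | h
    · rcases h1.lt_or_eq with h1 | h1
      · exact Or.inl (Or.inr ⟨h1, hxk, h⟩)
      · refine absurd (hJs ?_) hx
        refine H.mem_image_of_side_nonneg P.symm (left_mem_Icc.2 hlt.le) hs ht₂ ht₁ es₂ es₁ hls
          (fun r hr => ?_) h1.symm ?_
        · rw [side_swap]; linarith [hss r hr]
        · rw [side_swap]; linarith
    · rcases H.eq_of_side_eq_zero P ⟨h1, h2⟩ h with h | h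
      · exact absurd (h ▸ hJp _) hx
      · exact absurd (h ▸ hJq _) hx
    · rcases h2.lt_or_eq with h2 | h2
      · exact Or.inr (Or.inr ⟨h2, hxk, h⟩)
      · refine absurd (hJw ?_) hx
        exact H.mem_image_of_side_nonneg P (right_mem_Icc.2 hlt.le) hw hr₁ hr₂ ew₁ ew₂ hlw hsw h2
          h.le
  have hkU : k ∈ U := Or.inl (by
    show c₂ < v k
    rw [H.eq_one k H.mem]; exact P.lt_one)
  have hsub : connectedComponentIn Jᶜ k ⊆ U :=
    isPreconnected_connectedComponentIn.subset_left_of_subset_union hUo hVo hdisj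
      ((connectedComponentIn_subset _ _).trans hcov)
      ⟨k, mem_connectedComponentIn hJk, hkU⟩
  refine H.isBounded.closure.subset (hsub.trans fun x hx => (H.nonneg_iff x).1 ?_)
  have := P.nonneg
  have := P.lt
  rcases hx with h | ⟨h, -⟩ <;> simp only [mem_ofPred_eq] at h <;> linarith

end IsLevelFun

namespace IsLevelFun

variable {Ω K : Set E2} {k : E2} {v : E2 → ℝ} {Du : E2 → E2} {p q : ℝ → E2} {c₁ c₂ : ℝ}

/-- At a minimum of `v` over a ball, points of higher level lie on the side of the centre. -/
lemma inner_nonneg_of_isMin (H : IsLevelFun Ω K k v Du) {y y' z : E2} {r : ℝ}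
    (hb : closedBall y r ⊆ Ω \ K) (hy' : y' ∈ closedBall y r)
    (hmin : ∀ ζ ∈ closedBall y r, v y' ≤ v ζ) (hz : v y' ≤ v z) : 0 ≤ ⟪y - y', z - y'⟫ := by
  by_contra! hneg
  have hy'G := hb hy'
  have hy'c : y' ∈ closure Ω \ K := ⟨subset_closure hy'G.1, hy'G.2⟩
  have hd : 0 < ‖Du y'‖ := norm_pos_iff.2 (H.ne_zero y' hy'G)
  have hdk := H.inner_nonneg y' hy'c z hz
  obtain ⟨ε, hε, hε'⟩ : ∃ ε > 0, ε * ‖⟪y - y', Du y'⟫‖ < -⟪y - y', z - y'⟫ := by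
    have h1 : 0 < ‖⟪y - y', Du y'⟫‖ + 1 := by positivity
    have h2 : 0 < -⟪y - y', z - y'⟫ := by linarith
    refine ⟨-⟪y - y', z - y'⟫ / (‖⟪y - y', Du y'⟫‖ + 1), by positivity, ?_⟩
    rw [div_mul_eq_mul_div, div_lt_iff₀ h1]
    nlinarith
  set h : E2 := -(z - y') - ε • Du y' with hh
  have hpos : 0 < ⟪y - y', h⟫ := by
    rw [hh, inner_sub_right, inner_neg_right, inner_smul_right]
    have h1 : ε * ⟪y - y', Du y'⟫ ≤ ε * ‖⟪y - y', Du y'⟫‖ :=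
      mul_le_mul_of_nonneg_left (Real.le_norm_self _) hε.le
    linarith
  have hder : HasFDerivWithinAt (fun x => -v x) (innerSL ℝ (-Du y')) (closure Ω) y' := by
    rw [map_neg]
    exact (H.hasFDerivWithinAt y' hy'c).neg
  have hle := inner_le_of_le (h := h) (k := 0) hder ?_
  · rw [hh, inner_neg_left, inner_sub_right, inner_neg_right, inner_smul_right,
      real_inner_self_eq_norm_sq] at hle
    have : 0 < ε * ‖Du y'‖ ^ 2 := by positivity
    linarith
  · have hτ : ∀ᶠ τ : ℝ in nhdsWithin 0 (Ioi 0), τ * ‖h‖ ^ 2 < 2 * ⟪y - y', h⟫ := by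
      have hc : Continuous fun τ : ℝ => τ * ‖h‖ ^ 2 := by fun_prop
      have h0 : (0 : ℝ) * ‖h‖ ^ 2 < 2 * ⟪y - y', h⟫ := by rw [zero_mul]; linarith
      exact nhdsWithin_le_nhds (hc.continuousAt.eventually (gt_mem_nhds h0))
    filter_upwards [hτ, self_mem_nhdsWithin] with τ h1 h2
    have h2 : 0 < τ := h2
    rw [mem_closedBall, dist_eq_norm] at hy'
    have hmem : y' + τ • h ∈ closedBall y r := by
      rw [mem_closedBall, dist_eq_norm]
      refine le_trans ?_ hy'
      refine le_of_sq_le_sq ?_ (norm_nonneg _)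
      have e : y' + τ • h - y = τ • h - (y - y') := by abel
      rw [e, @norm_sub_sq_real, norm_smul, inner_smul_left, norm_sub_rev y' y,
        real_inner_comm, Real.norm_eq_abs, mul_pow, sq_abs]
      simp only [conj_trivial]
      nlinarith
    refine ⟨subset_closure (hb hmem).1, ?_⟩
    linarith [hmin _ hmem]

/-- Going down one step, the distance to the curve `p` decreases in a controlled way. -/
lemma sq_norm_sub_le (H : IsLevelFun Ω K k v Du) (hp : ∀ c ∈ Icc c₁ c₂, v (p c) = c)
    (hanti : ∀ z, ∀ c ∈ Icc c₁ c₂, ∀ d ∈ Icc c₁ c₂, c ≤ d → d ≤ v z → ‖p d - z‖ ≤ ‖p c - z‖)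
    {y y' : E2} {r : ℝ} (hb : closedBall y r ⊆ Ω \ K) (hy' : y' ∈ closedBall y r)
    (hmin : ∀ ζ ∈ closedBall y r, v y' ≤ v ζ) (hle : v y' ≤ v y) (hyc : v y ∈ Icc c₁ c₂)
    (hyc' : v y' ∈ Icc c₁ c₂) :
    ‖y - p (v y)‖ ^ 2 ≤ ‖y' - p (v y')‖ ^ 2 + r ^ 2 := by
  have h1 := H.inner_nonneg_of_isMin hb hy' hmin (z := p (v y')) (hp _ hyc').ge
  have h2 := hanti y _ hyc' _ hyc hle le_rfl
  rw [mem_closedBall, dist_eq_norm, norm_sub_rev] at hy'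
  have h3 : ‖p (v y') - y‖ ^ 2 ≤ ‖y' - p (v y')‖ ^ 2 + r ^ 2 := by
    have e : p (v y') - y = (p (v y') - y') - (y - y') := by abel
    rw [e, @norm_sub_sq_real, norm_sub_rev (p (v y')) y', real_inner_comm]
    have : ‖y - y'‖ ^ 2 ≤ r ^ 2 := by gcongr
    linarith
  rw [norm_sub_rev] at h2
  have h4 : ‖y - p (v y)‖ ^ 2 ≤ ‖p (v y') - y‖ ^ 2 := by gcongr
  linarith

/-- Speed at an upper point on one side is attained at some point of the lower level on that
side. -/
lemma exists_norm_grad_ge (H : IsLevelFun Ω K k v Du) (P : IsLevelPair k v p q c₁ c₂)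
    (hp : ∀ z, ∀ c ∈ Icc c₁ c₂, ∀ d ∈ Icc c₁ c₂, c ≤ d → d ≤ v z → ‖p d - z‖ ≤ ‖p c - z‖)
    (hq : ∀ z, ∀ c ∈ Icc c₁ c₂, ∀ d ∈ Icc c₁ c₂, c ≤ d → d ≤ v z → ‖q d - z‖ ≤ ‖q c - z‖)
    {x : E2} (hx : v x = c₂) (hs : 0 ≤ side k v p q x) (hxp : x ≠ p c₂) (hxq : x ≠ q c₂) :
    ∃ y, v y = c₁ ∧ 0 ≤ side k v p q y ∧ ‖Du x‖ ≤ ‖Du y‖ := by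
  have hv := H.continuous
  have hlt := P.lt
  have hc0 := P.nonneg
  have hc1 := P.lt_one
  have hmemK : ∀ {y}, v y ≤ c₂ → y ∉ K := fun {y} h h' => by
    rw [H.eq_one y h'] at h; linarith
  have hxG : x ∈ Ω \ K := ⟨H.mem_of_pos x (by rw [hx]; linarith), hmemK hx.le⟩
  set S := ‖Du x‖ with hS
  have hS0 : 0 < S := norm_pos_iff.2 (H.ne_zero x hxG)
  set D := min (‖x - p c₂‖ ^ 2) (‖x - q c₂‖ ^ 2) with hD
  have hD0 : 0 < D := lt_min (pow_pos (norm_pos_iff.2 (sub_ne_zero.2 hxp)) 2)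
    (pow_pos (norm_pos_iff.2 (sub_ne_zero.2 hxq)) 2)
  set η := D / (2 * (c₂ - c₁)) with hη
  have hcc : 0 < c₂ - c₁ := by linarith
  have hη0 : 0 < η := by positivity
  have hηD : η * (c₂ - c₁) = D / 2 := by rw [hη]; field_simp
  set C := v ⁻¹' Icc c₁ c₂ with hC
  have hCc : IsClosed C := isClosed_Icc.preimage hv
  have hCΩ : C ⊆ closure Ω \ K := fun y hy =>
    ⟨(H.nonneg_iff y).1 (hc0.trans hy.1), hmemK hy.2⟩
  have hCcomp : IsCompact C := H.isBounded.isCompact_closure.of_isClosed_subset hCc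
    fun y hy => (hCΩ hy).1
  have hCk : C ⊆ {k}ᶜ := fun y hy => H.ne_of_lt_one (hy.2.trans_lt hc1)
  have hsc := P.continuousOn_side hv
  have hpc := P.continuous_left
  have hqc := P.continuous_right
  set Z := (C ∩ side k v p q ⁻¹' Ici 0) ∩ (C ∩ (fun y => ‖Du y‖) ⁻¹' Ici S) ∩
    ({y | D - η * (c₂ - v y) ≤ ‖y - p (v y)‖ ^ 2} ∩
      {y | D - η * (c₂ - v y) ≤ ‖y - q (v y)‖ ^ 2}) with hZ
  have hZc : IsClosed Z := by
    refine ((((hsc.mono hCk).preimage_isClosed_of_isClosed hCc isClosed_Ici).inter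
      ((H.continuousOn_grad.mono hCΩ).norm.preimage_isClosed_of_isClosed hCc isClosed_Ici))).inter
      ((isClosed_le ?_ ?_).inter (isClosed_le ?_ ?_)) <;> fun_prop
  have hZcomp : IsCompact Z := hCcomp.of_isClosed_subset hZc fun y hy => hy.1.1.1
  have hxC : x ∈ C := ⟨by rw [hx]; exact hlt.le, hx.le⟩
  have hxZ : x ∈ Z := by
    refine ⟨⟨⟨hxC, hs⟩, hxC, le_refl (‖Du x‖)⟩, ?_, ?_⟩
    · show D - η * (c₂ - v x) ≤ ‖x - p (v x)‖ ^ 2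
      rw [hx, sub_self, mul_zero, sub_zero]; exact min_le_left _ _
    · show D - η * (c₂ - v x) ≤ ‖x - q (v x)‖ ^ 2
      rw [hx, sub_self, mul_zero, sub_zero]; exact min_le_right _ _
  obtain ⟨y, hyZ, hymin⟩ := hZcomp.exists_isMinOn ⟨x, hxZ⟩ hv.continuousOn
  obtain ⟨⟨⟨hyC, hys⟩, -, hyS⟩, hyp, hyq⟩ := hyZ
  have hys : 0 ≤ side k v p q y := hys
  have hyS : S ≤ ‖Du y‖ := hyS
  have hyp : D - η * (c₂ - v y) ≤ ‖y - p (v y)‖ ^ 2 := hyp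
  have hyq : D - η * (c₂ - v y) ≤ ‖y - q (v y)‖ ^ 2 := hyq
  rcases hyC.1.eq_or_lt with hy1 | hy1
  · exact ⟨y, hy1.symm, hys, hyS⟩
  exfalso
  have hyG : y ∈ Ω \ K := ⟨H.mem_of_pos y (by linarith), hmemK hyC.2⟩
  have hDpos : 0 < D - η * (c₂ - v y) := by
    have : η * (c₂ - v y) ≤ η * (c₂ - c₁) := by gcongr
    linarith
  have hys' : 0 < side k v p q y := by
    refine hys.lt_of_ne fun h => ?_
    rcases H.eq_of_side_eq_zero P hyC h.symm with h | h
    · rw [← h] at hyp; simp at hyp; linarith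
    · rw [← h] at hyq; simp at hyq; linarith
  have hN : ((Ω \ K) ∩ {z | c₁ < v z}) ∩ ({k}ᶜ ∩ side k v p q ⁻¹' Ioi 0) ∈ nhds y := by
    refine IsOpen.mem_nhds ?_ ⟨⟨hyG, hy1⟩, hCk hyC, hys'⟩
    exact ((H.isOpen.sdiff H.isClosed).inter (isOpen_lt continuous_const hv)).inter
      (hsc.isOpen_inter_preimage isOpen_compl_singleton isOpen_Ioi)
  obtain ⟨r₀, hr₀, hball⟩ := Metric.nhds_basis_closedBall.mem_iff.1 hN
  set r := min r₀ (η * S) with hr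
  have hr0 : 0 < r := lt_min hr₀ (by positivity)
  have hball' := (closedBall_subset_closedBall (x := y) (min_le_left r₀ (η * S))).trans hball
  have hbG : closedBall y r ⊆ Ω \ K := fun z hz => (hball' hz).1.1
  obtain ⟨y', hy', hmin, hdesc, hsp⟩ := H.exists_descent y r hr0 hbG
  have hdrop : S * r ≤ v y - v y' := by
    have : S * r ≤ ‖Du y‖ * r := by gcongr
    linarith
  have hlt' : v y' < v y := by
    have : 0 < S * r := by positivity
    linarith
  have hyC' : v y' ∈ Icc c₁ c₂ := ⟨(hball' hy').1.2.le, hlt'.le.trans hyC.2⟩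
  have hr2 : r ^ 2 ≤ η * (v y - v y') := by
    calc r ^ 2 = r * r := sq r
      _ ≤ (η * S) * r := by gcongr; exact min_le_right _ _
      _ = η * (S * r) := by ring
      _ ≤ η * (v y - v y') := by gcongr
  have h1 := H.sq_norm_sub_le P.level_left hp hbG hy' hmin hlt'.le hyC hyC'
  have h2 := H.sq_norm_sub_le P.level_right hq hbG hy' hmin hlt'.le hyC hyC'
  have hyZ' : y' ∈ Z := by
    refine ⟨⟨⟨hyC', ?_⟩, hyC', hyS.trans hsp⟩, ?_, ?_⟩
    · have : 0 < side k v p q y' := (hball' hy').2.2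
      exact this.le
    · show D - η * (c₂ - v y') ≤ ‖y' - p (v y')‖ ^ 2
      linarith
    · show D - η * (c₂ - v y') ≤ ‖y' - q (v y')‖ ^ 2
      linarith
  exact absurd (hymin hyZ') (not_le.2 hlt')

end IsLevelFun

namespace IsLevelFun

variable {Ω K : Set E2} {k : E2} {v : E2 → ℝ} {Du : E2 → E2} {p q : ℝ → E2} {c₁ c₂ : ℝ}

/-- The comparison of speeds when the upper arc lies on the nonnegative side. -/
lemma norm_grad_le_of_side_nonneg (H : IsLevelFun Ω K k v Du) (P : IsLevelPair k v p q c₁ c₂)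
    (hp : ∀ z, ∀ c ∈ Icc c₁ c₂, ∀ d ∈ Icc c₁ c₂, c ≤ d → d ≤ v z → ‖p d - z‖ ≤ ‖p c - z‖)
    (hq : ∀ z, ∀ c ∈ Icc c₁ c₂, ∀ d ∈ Icc c₁ c₂, c ≤ d → d ≤ v z → ‖q d - z‖ ≤ ‖q c - z‖)
    {J : Set E2} {s w : ℝ → E2} {r₁ r₂ t₁ t₂ : ℝ} (hs : ContinuousOn s (Icc 0 1))
    (hw : ContinuousOn w (Icc 0 1)) (hsi : InjOn s (Icc 0 1)) (hwi : InjOn w (Icc 0 1))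
    (hr : r₁ = 0 ∧ r₂ = 1 ∨ r₁ = 1 ∧ r₂ = 0) (ht : t₁ = 0 ∧ t₂ = 1 ∨ t₁ = 1 ∧ t₂ = 0)
    (ew₁ : w r₁ = p c₂) (ew₂ : w r₂ = q c₂) (es₁ : s t₁ = p c₁) (es₂ : s t₂ = q c₁)
    (hlw : ∀ r ∈ Icc (0 : ℝ) 1, v (w r) = c₂) (hls : ∀ r ∈ Icc (0 : ℝ) 1, v (s r) = c₁)
    (hJw : w '' Icc 0 1 ⊆ J) (hJs : s '' Icc 0 1 ⊆ J) (hJp : ∀ c, p c ∈ J) (hJq : ∀ c, q c ∈ J)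
    (hJk : k ∉ J) (hb : ¬ Bornology.IsBounded (connectedComponentIn Jᶜ k))
    (hsw : ∀ r ∈ Icc (0 : ℝ) 1, 0 ≤ side k v p q (w r)) {r : ℝ} (hr0 : r ∈ Ioo (0 : ℝ) 1) :
    ∃ y ∈ s '' Icc 0 1, ‖Du (w r)‖ ≤ ‖Du y‖ := by
  have hr₁ : r₁ ∈ Icc (0 : ℝ) 1 := by rcases hr with h | h <;> simp [h.1]
  have hr₂ : r₂ ∈ Icc (0 : ℝ) 1 := by rcases hr with h | h <;> simp [h.2]
  have ht₁ : t₁ ∈ Icc (0 : ℝ) 1 := by rcases ht with h | h <;> simp [h.1]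
  have ht₂ : t₂ ∈ Icc (0 : ℝ) 1 := by rcases ht with h | h <;> simp [h.2]
  have hc : c₁ ∈ Icc c₁ c₂ := left_mem_Icc.2 P.lt.le
  have hss : ∀ r ∈ Icc (0 : ℝ) 1, 0 ≤ side k v p q (s r) :=
    (H.side_nonneg_or_nonpos P hc hs hsi ht es₁ es₂ hls).resolve_right fun h =>
      hb (H.isBounded_component P hs hw hr₁ hr₂ ht₁ ht₂ ew₁ ew₂ es₁ es₂ hlw hls hsw h hJw hJs
        hJp hJq hJk)
  have hrI := Ioo_subset_Icc_self hr0
  have hne : ∀ r' ∈ Icc (0 : ℝ) 1, r' = 0 ∨ r' = 1 → w r ≠ w r' := by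
    intro r' hr' h e
    have := hwi hrI hr' e
    rcases h with h | h
    · exact hr0.1.ne' (this.trans h)
    · exact hr0.2.ne (this.trans h)
  obtain ⟨y, hy, hys, hle⟩ := H.exists_norm_grad_ge P hp hq (hlw r hrI) (hsw r hrI)
    (ew₁ ▸ hne r₁ hr₁ (by tauto)) (ew₂ ▸ hne r₂ hr₂ (by tauto))
  exact ⟨y, H.mem_image_of_side_nonneg P hc hs ht₁ ht₂ es₁ es₂ hls hss hy hys, hle⟩

/-- The comparison of speeds on the two level arcs of a quadrilateral whose sides are
parametrized by level. -/
lemma sSup_norm_grad_le (H : IsLevelFun Ω K k v Du) (P : IsLevelPair k v p q c₁ c₂)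
    (hp : ∀ z, ∀ c ∈ Icc c₁ c₂, ∀ d ∈ Icc c₁ c₂, c ≤ d → d ≤ v z → ‖p d - z‖ ≤ ‖p c - z‖)
    (hq : ∀ z, ∀ c ∈ Icc c₁ c₂, ∀ d ∈ Icc c₁ c₂, c ≤ d → d ≤ v z → ‖q d - z‖ ≤ ‖q c - z‖)
    {J : Set E2} {s w : ℝ → E2} {r₁ r₂ t₁ t₂ : ℝ} (hs : ContinuousOn s (Icc 0 1))
    (hw : ContinuousOn w (Icc 0 1)) (hsi : InjOn s (Icc 0 1)) (hwi : InjOn w (Icc 0 1))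
    (hr : r₁ = 0 ∧ r₂ = 1 ∨ r₁ = 1 ∧ r₂ = 0) (ht : t₁ = 0 ∧ t₂ = 1 ∨ t₁ = 1 ∧ t₂ = 0)
    (ew₁ : w r₁ = p c₂) (ew₂ : w r₂ = q c₂) (es₁ : s t₁ = p c₁) (es₂ : s t₂ = q c₁)
    (hlw : ∀ r ∈ Icc (0 : ℝ) 1, v (w r) = c₂) (hls : ∀ r ∈ Icc (0 : ℝ) 1, v (s r) = c₁)
    (hJw : w '' Icc 0 1 ⊆ J) (hJs : s '' Icc 0 1 ⊆ J) (hJp : ∀ c, p c ∈ J) (hJq : ∀ c, q c ∈ J)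
    (hJΩ : J ⊆ closure Ω \ K) (hb : ¬ Bornology.IsBounded (connectedComponentIn Jᶜ k)) :
    sSup ((fun x => ‖Du x‖) '' (w '' Icc 0 1)) ≤ sSup ((fun x => ‖Du x‖) '' (s '' Icc 0 1)) := by
  have hJk : k ∉ J := fun h => (hJΩ h).2 H.mem
  have hIoo : ∀ r ∈ Ioo (0 : ℝ) 1, ∃ y ∈ s '' Icc 0 1, ‖Du (w r)‖ ≤ ‖Du y‖ := by
    intro r hr0
    rcases H.side_nonneg_or_nonpos P (right_mem_Icc.2 P.lt.le) hw hwi hr ew₁ ew₂ hlw with h | h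
    · exact H.norm_grad_le_of_side_nonneg P hp hq hs hw hsi hwi hr ht ew₁ ew₂ es₁ es₂ hlw hls hJw
        hJs hJp hJq hJk hb h hr0
    · exact H.norm_grad_le_of_side_nonneg P.symm hq hp hs hw hsi hwi (by tauto) (by tauto)
        ew₂ ew₁ es₂ es₁ hlw hls hJw hJs hJq hJp hJk hb
        (fun r hr => by rw [side_swap]; linarith [h r hr]) hr0
  have hDw : ContinuousOn (fun r => ‖Du (w r)‖) (Icc 0 1) :=
    ((H.continuousOn_grad.mono hJΩ).comp hw fun r hr => hJw ⟨r, hr, rfl⟩).norm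
  have hbdd : BddAbove ((fun x => ‖Du x‖) '' (s '' Icc 0 1)) :=
    ((isCompact_Icc.image_of_continuousOn hs).image_of_continuousOn
      ((H.continuousOn_grad.mono (hJs.trans hJΩ)).norm)).bddAbove
  set M := sSup ((fun x => ‖Du x‖) '' (s '' Icc 0 1)) with hM
  have hIM : Ioo (0 : ℝ) 1 ⊆ Icc 0 1 ∩ (fun r => ‖Du (w r)‖) ⁻¹' Iic M := fun r hr => by
    obtain ⟨y, hy, hle⟩ := hIoo r hr
    exact ⟨Ioo_subset_Icc_self hr, hle.trans (le_csSup hbdd ⟨y, hy, rfl⟩)⟩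
  have hIccM := closure_minimal hIM (hDw.preimage_isClosed_of_isClosed isClosed_Icc isClosed_Iic)
  rw [closure_Ioo zero_ne_one] at hIccM
  refine csSup_le (((nonempty_Icc.2 zero_le_one).image _).image _) ?_
  rintro _ ⟨_, ⟨r, hr, rfl⟩, rfl⟩
  exact (hIccM hr).2

end IsLevelFun

/-- A curve approaching its superlevel sets meets an arc of a level set in at most one point. -/
lemma exists_level_inter_subset_singleton {v : E2 → ℝ} {g w : ℝ → E2} {T c : ℝ}
    (hd : ∀ z, ∀ s ∈ Icc 0 T, ∀ t ∈ Icc 0 T, s ≤ t → v (g t) ≤ v z → ‖g t - z‖ ≤ ‖g s - z‖)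
    (hw : ∀ r ∈ Icc (0 : ℝ) 1, v (w r) = c) :
    ∃ x, g '' Icc 0 T ∩ w '' Icc 0 1 ⊆ {x} := by
  have key : ∀ s ∈ Icc 0 T, ∀ t ∈ Icc 0 T, s ≤ t → v (g s) = v (g t) → g s = g t := by
    intro s hs t ht hst hv
    have := hd (g s) s hs t ht hst hv.ge
    rw [sub_self, norm_zero] at this
    exact (sub_eq_zero.1 (norm_le_zero_iff.1 this)).symm
  have hsub : (g '' Icc 0 T ∩ w '' Icc 0 1).Subsingleton := by
    rintro _ ⟨⟨s, hs, rfl⟩, r, hr, e⟩ _ ⟨⟨t, ht, rfl⟩, r', hr', e'⟩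
    have hv : v (g s) = v (g t) := by rw [← e, ← e', hw r hr, hw r' hr']
    rcases le_total s t with h | h
    · exact key s hs t ht h hv
    · exact (key t ht s hs h hv.symm).symm
  rcases hsub.eq_empty_or_singleton with h | ⟨x, h⟩
  · exact ⟨0, h ▸ empty_subset _⟩
  · exact ⟨x, h.subset⟩

/-- **Lemma (maximum principle for the quadrilateral).** In the quadrilateral
configuration bounded by the streamlines `α`, `β` and the level arcs `σ` (lower) and `ω`
(upper), the maximal speed on the upper level arc is at most the maximal speed on the
lower level arc. -/
theorem quadrilateral_max_speed_upper_le_lower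
    (Ω K G : Set E2) (u : E2 → ℝ) (Du : E2 → E2)
    (hΩo : IsOpen Ω) (hΩb : Bornology.IsBounded Ω) (hΩconv : Convex ℝ Ω)
    (hKcp : IsCompact K) (hKconv : Convex ℝ K) (hKne : K.Nonempty) (hKΩ : K ⊆ Ω)
    (hG : G = Ω \ K)
    (hdist : sInf (Set.image2 dist (frontier Ω) K) = 1)
    (hu_cont : ContinuousOn u (closure G))
    (hu0 : ∀ x ∈ frontier Ω, u x = 0)
    (hu1 : ∀ x ∈ frontier K, u x = 1)
    (hDu : ∀ x ∈ G, HasGradientAt u (Du x) x)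
    (hDu_cont : ContinuousOn Du (closure Ω \ K))
    (hDu_ne : ∀ x ∈ G, Du x ≠ 0)
    (hvisc : ViscosityInftyHarmonic u G)
    -- the quadrilateral configuration
    (c₁ c₂ : ℝ) (hc₁ : 0 ≤ c₁) (hc₁₂ : c₁ < c₂) (hc₂ : c₂ < 1)
    (α β : ℝ → E2) (Tα Tβ : ℝ)
    (hα : IsStreamline G Du α Tα) (hβ : IsStreamline G Du β Tβ)
    (a b a' b' : E2)
    (ha : a = α 0) (hb : b = β 0) (ha' : a' = α Tα) (hb' : b' = β Tβ)
    (hua : u a = c₁) (hub : u b = c₁) (hua' : u a' = c₂) (hub' : u b' = c₂)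
    (hdisj : Disjoint (α '' Set.Icc 0 Tα) (β '' Set.Icc 0 Tβ))
    (σ ω : Set E2)
    (hσ : ∃ s : ℝ → E2, ContinuousOn s (Set.Icc 0 1) ∧ Set.InjOn s (Set.Icc 0 1) ∧
      s 0 = a ∧ s 1 = b ∧ (∀ r ∈ Set.Icc (0:ℝ) 1, u (s r) = c₁) ∧ σ = s '' Set.Icc 0 1)
    (hω : ∃ w : ℝ → E2, ContinuousOn w (Set.Icc 0 1) ∧ Set.InjOn w (Set.Icc 0 1) ∧
      w 0 = a' ∧ w 1 = b' ∧ (∀ r ∈ Set.Icc (0:ℝ) 1, u (w r) = c₂) ∧ ω = w '' Set.Icc 0 1)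
    (J : Set E2) (hJ : J = σ ∪ ω ∪ α '' Set.Icc 0 Tα ∪ β '' Set.Icc 0 Tβ)
    (hJordan : IsJordanCurve J)
    (Q : Set E2)
    (hQ : Q = J ∪ {x | x ∉ J ∧ Bornology.IsBounded (connectedComponentIn Jᶜ x)})
    (hQG : Q \ frontier Ω ⊆ G) :
    sSup ((fun x => ‖Du x‖) '' ω) ≤ sSup ((fun x => ‖Du x‖) '' σ) := by
  subst hG
  obtain ⟨k, hk⟩ := hKne
  obtain ⟨v₀, hv₀, hv₀u⟩ :=
    exists_isPotential hΩo hΩb hΩconv hKcp hKconv hKΩ hu_cont hu0 hu1 hDu hDu_ne hvisc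
  have H := hv₀.isLevelFun hDu_cont hk
  have hvu : ∀ x ∈ closure Ω \ K, v₀ x - infDist x (closure Ω) = u x := fun x hx => by
    rw [infDist_zero_of_mem hx.1, sub_zero, hv₀u x hx]
  set v : E2 → ℝ := fun x => v₀ x - infDist x (closure Ω)
  have hJΩ : J ⊆ closure Ω \ K := fun x hx => by
    by_cases hxΩ : x ∈ frontier Ω
    · exact ⟨hxΩ.1, fun h => disjoint_left.1 (disjoint_frontier_iff_isOpen.2 hΩo) hxΩ (hKΩ h)⟩
    · have := hQG ⟨hQ ▸ Or.inl hx, hxΩ⟩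
      exact ⟨subset_closure this.1, this.2⟩
  have hkJ : k ∉ J := fun h => (hJΩ h).2 hk
  have hbk : ¬ Bornology.IsBounded (connectedComponentIn Jᶜ k) := fun h =>
    (hQG ⟨hQ ▸ Or.inr ⟨hkJ, h⟩, fun h' =>
      disjoint_left.1 (disjoint_frontier_iff_isOpen.2 hΩo) h' (hKΩ hk)⟩).2 hk
  obtain ⟨s, hs, hsi, hs0, hs1, hsu, rfl⟩ := hσ
  obtain ⟨w, hw, hwi, hw0, hw1, hwu, rfl⟩ := hω
  have hJs : s '' Icc 0 1 ⊆ J := fun x hx => hJ ▸ Or.inl (Or.inl (Or.inl hx))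
  have hJw : w '' Icc 0 1 ⊆ J := fun x hx => hJ ▸ Or.inl (Or.inl (Or.inr hx))
  have hJα : α '' Icc 0 Tα ⊆ J := fun x hx => hJ ▸ Or.inl (Or.inr hx)
  have hJβ : β '' Icc 0 Tβ ⊆ J := fun x hx => hJ ▸ Or.inr hx
  have hls : ∀ r ∈ Icc (0 : ℝ) 1, v (s r) = c₁ := fun r hr =>
    (hvu _ (hJΩ (hJs ⟨r, hr, rfl⟩))).trans (hsu r hr)
  have hlw : ∀ r ∈ Icc (0 : ℝ) 1, v (w r) = c₂ := fun r hr =>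
    (hvu _ (hJΩ (hJw ⟨r, hr, rfl⟩))).trans (hwu r hr)
  have h0 : (0 : ℝ) ∈ Icc (0 : ℝ) 1 := ⟨le_rfl, zero_le_one⟩
  have h1 : (1 : ℝ) ∈ Icc (0 : ℝ) 1 := ⟨zero_le_one, le_rfl⟩
  have hTα : 0 < Tα := hα.1.lt_of_ne fun h => by
    rw [ha', ← h, ← ha, hua] at hua'; exact hc₁₂.ne hua'
  have hTβ : 0 < Tβ := hβ.1.lt_of_ne fun h => by
    rw [hb', ← h, ← hb, hub] at hub'; exact hc₁₂.ne hub'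
  have hJc := hJordan.isCompact
  obtain ⟨g, hg, hgα, hgJ, hgm, hgd⟩ := H.exists_streamline_extension hJc hJΩ hα hTα hJα
  obtain ⟨f, hf, hfβ, hfJ, hfm, hfd⟩ := H.exists_streamline_extension hJc hJΩ hβ hTβ hJβ
  obtain ⟨pA, hpA⟩ := exists_level_inter_subset_singleton (w := w) hgd hlw
  obtain ⟨pB, hpB⟩ := exists_level_inter_subset_singleton (w := w) hfd hlw
  have hga : g 0 = s 0 := by rw [hgα ⟨le_rfl, hTα⟩, hs0, ha]
  have hfb : f 0 = s 1 := by rw [hfβ ⟨le_rfl, hTβ⟩, hs1, hb]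
  have hcov : J = s '' Icc 0 1 ∪ w '' Icc 0 1 ∪ g '' Icc 0 Tα ∪ f '' Icc 0 Tβ := by
    apply Subset.antisymm
    · rw [hJ]
      rintro x (((hx | hx) | ⟨t, ht, rfl⟩) | ⟨t, ht, rfl⟩)
      · exact Or.inl (Or.inl (Or.inl hx))
      · exact Or.inl (Or.inl (Or.inr hx))
      · rcases ht.2.eq_or_lt with h | h
        · exact Or.inl (Or.inl (Or.inr ⟨0, h0, by rw [hw0, ha', h]⟩))
        · exact Or.inl (Or.inr ⟨t, ht, hgα ⟨ht.1, h⟩⟩)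
      · rcases ht.2.eq_or_lt with h | h
        · exact Or.inl (Or.inl (Or.inr ⟨1, h1, by rw [hw1, hb', h]⟩))
        · exact Or.inr ⟨t, ht, hfβ ⟨ht.1, h⟩⟩
    · rintro x (((hx | hx) | ⟨t, ht, rfl⟩) | ⟨t, ht, rfl⟩)
      exacts [hJs hx, hJw hx, hgJ t ht, hfJ t ht]
  have hdsw : Disjoint (s '' Icc 0 1) (w '' Icc 0 1) := by
    rw [disjoint_left]
    rintro _ ⟨r, hr, rfl⟩ ⟨t, ht, e⟩
    exact hc₁₂.ne ((hls r hr).symm.trans ((congrArg v e.symm).trans (hlw t ht)))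
  obtain ⟨r₁, r₂, hr, ew₁, ew₂, ⟨tA, htA, egA⟩, tB, htB, efB⟩ := arc_endpoints_eq hJordan hw hwi
    (isCompact_Icc.image_of_continuousOn hs).isClosed (isCompact_Icc.image hg).isClosed
    (isCompact_Icc.image hf).isClosed hcov hdsw hpA hpB
    ⟨s 0, ⟨0, h0, rfl⟩, s 1, ⟨1, h1, rfl⟩, fun h => zero_ne_one (hsi h0 h1 h)⟩
  have hr₁ : r₁ ∈ Icc (0 : ℝ) 1 := by rcases hr with h | h <;> simp [h.1]
  have hr₂ : r₂ ∈ Icc (0 : ℝ) 1 := by rcases hr with h | h <;> simp [h.2]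
  have hAB : pA ≠ pB := fun h => by
    have := hwi hr₁ hr₂ (ew₁.trans (h.trans ew₂.symm))
    rcases hr with h | h <;> rw [h.1, h.2] at this <;> norm_num at this
  have hvA : v (g tA) = c₂ := by rw [egA, ← ew₁, hlw r₁ hr₁]
  have hvB : v (f tB) = c₂ := by rw [efB, ← ew₂, hlw r₂ hr₂]
  have hsubA : Icc 0 tA ⊆ Icc 0 Tα := Icc_subset_Icc_right htA.2
  have hsubB : Icc 0 tB ⊆ Icc 0 Tβ := Icc_subset_Icc_right htB.2
  obtain ⟨p, hpc, hpl, hpi, hpv, hpd⟩ := exists_level_parametrization H.continuous hg htA.1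
    (hgm.mono hsubA) (fun z s hs t ht => hgd z s (hsubA hs) t (hsubA ht))
    (by rw [hga, hls 0 h0]) hvA
  obtain ⟨q, hqc, hql, hqi, hqv, hqd⟩ := exists_level_parametrization H.continuous hf htB.1
    (hfm.mono hsubB) (fun z s hs t ht => hfd z s (hsubB hs) t (hsubB ht))
    (by rw [hfb, hls 1 h1]) hvB
  have hp₁ : p c₁ = s 0 := by rw [← hga, ← hpv 0 ⟨le_rfl, htA.1⟩, hga, hls 0 h0]
  have hq₁ : q c₁ = s 1 := by rw [← hfb, ← hqv 0 ⟨le_rfl, htB.1⟩, hfb, hls 1 h1]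
  have hp₂ : p c₂ = pA := by rw [← egA, ← hpv tA ⟨htA.1, le_rfl⟩, hvA]
  have hq₂ : q c₂ = pB := by rw [← efB, ← hqv tB ⟨htB.1, le_rfl⟩, hvB]
  have hpJ : ∀ c, p c ∈ J := fun c => by
    obtain ⟨t, ht, e⟩ := hpi c
    exact e ▸ hgJ t (hsubA ht)
  have hqJ : ∀ c, q c ∈ J := fun c => by
    obtain ⟨t, ht, e⟩ := hqi c
    exact e ▸ hfJ t (hsubB ht)
  have hpq : ∀ c ∈ Icc c₁ c₂, p c ≠ q c := by
    intro c hc e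
    obtain ⟨t, ht, et⟩ := hpi c
    obtain ⟨t', ht', et'⟩ := hqi c
    have hcc : c ≠ c₂ := fun h => hAB (by rw [← hp₂, ← hq₂, ← h, e])
    have htT : t < Tα := (ht.2.trans htA.2).lt_of_ne fun h => hcc (by
      rw [← hpl c hc, ← et, ← hvA, le_antisymm ht.2 (h ▸ htA.2)])
    have htT' : t' < Tβ := (ht'.2.trans htB.2).lt_of_ne fun h => hcc (by
      rw [← hql c hc, ← et', ← hvB, le_antisymm ht'.2 (h ▸ htB.2)])
    refine disjoint_left.1 hdisj ⟨t, ⟨ht.1, htT.le⟩, (hgα ⟨ht.1, htT⟩).symm⟩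
      ⟨t', ⟨ht'.1, htT'.le⟩, ?_⟩
    rw [← hfβ ⟨ht'.1, htT'⟩, et', ← e, et]
  have P : IsLevelPair k v p q c₁ c₂ := ⟨hc₁, hc₁₂, hc₂, hpc, hqc, hpl, hql, hpq,
    fun c h => hkJ (h ▸ hpJ c), fun c h => hkJ (h ▸ hqJ c)⟩
  exact H.sSup_norm_grad_le P hpd hqd hs hw hsi hwi hr (Or.inl ⟨rfl, rfl⟩) (ew₁.trans hp₂.symm)
    (ew₂.trans hq₂.symm) hp₁.symm hq₁.symm hlw hls hJw hJs hpJ hqJ hJΩ hbk
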